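/- Fix t ∈ ℝ^d and define the Fisher information matrix I^n(t) = (I^n_{ij}(t))_{1≤i,j≤d} by I^n_{ij}(t) := ∫ ∂_i[log ν_s([x₀,…,x_{n−1}])](t) · ∂_j[log ν_s([x₀,…,x_{n−1}])](t) dν_t(x). Then for all 1 ≤ i,j ≤ d both limits below exist and lim_{n→∞} (1/n) I^n_{ij}(t) = lim_{m→∞} (1/m) ∫ S_m f̃_i^t · S_m f̃_j^t dν_t, where f̃_i^t := f_i − ∫ f_i dμ_t. -/

import Mathlib

open MeasureTheory Filter

namespace GibbsPaper

/-- Prepend a symbol to a one-sided sequence. -/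
def cons {a : ℕ} (i : Fin a) (x : ℕ → Fin a) : ℕ → Fin a
  | 0 => i
  | n + 1 => x n

/-- The left shift on sequence space. -/
def shift {a : ℕ} (x : ℕ → Fin a) : ℕ → Fin a := fun n => x (n + 1)

/-- The subshift of finite type determined by the incidence matrix `A`. -/
def SFT {a : ℕ} (A : Fin a → Fin a → Bool) : Set (ℕ → Fin a) :=
  {x | ∀ n, A (x n) (x (n + 1)) = true}

/-- Topological mixing of the subshift, phrased via admissible connecting words. -/
def Mixing {a : ℕ} (A : Fin a → Fin a → Bool) : Prop :=
  ∃ N : ℕ, ∀ n ≥ N, ∀ i j : Fin a, ∃ w : ℕ → Fin a,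
    w 0 = i ∧ w n = j ∧ ∀ k < n, A (w k) (w (k + 1)) = true

/-- Birkhoff sum `S_n h = ∑_{k<n} h ∘ σ^k`. -/
def birkhoff {a : ℕ} (n : ℕ) (h : (ℕ → Fin a) → ℝ) (x : ℕ → Fin a) : ℝ :=
  ∑ k ∈ Finset.range n, h (shift^[k] x)

/-- Hölder continuity with respect to the cylinder (product) structure. -/
def HolderSeq {a : ℕ} (f : (ℕ → Fin a) → ℝ) : Prop :=
  Continuous f ∧ ∃ C ρ : ℝ, 0 < ρ ∧ ρ < 1 ∧
    ∀ n : ℕ, ∀ x y : ℕ → Fin a, (∀ i < n, x i = y i) → |f x - f y| ≤ C * ρ ^ n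

/-- The cylinder `[c₀,…,c_{n-1}]` inside the subshift `Ω = SFT A`. -/
def cyl {a : ℕ} (A : Fin a → Fin a → Bool) (n : ℕ) (c : ℕ → Fin a) : Set (ℕ → Fin a) :=
  {x ∈ SFT A | ∀ i < n, x i = c i}

/-- The Ruelle transfer operator `L_F g (x) = ∑_{σ y = x} e^{F y} g y`. -/
noncomputable def transfer {a : ℕ} (A : Fin a → Fin a → Bool)
    (F g : (ℕ → Fin a) → ℝ) (x : ℕ → Fin a) : ℝ :=
  ∑ i : Fin a, if A i (x 0) = true then Real.exp (F (cons i x)) * g (cons i x) else 0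

/-- `ν` is a probability eigenmeasure of the dual transfer operator `L_F^*` with
eigenvalue `lam`, supported on the subshift. -/
def Eigenmeasure {a : ℕ} (A : Fin a → Fin a → Bool) (F : (ℕ → Fin a) → ℝ)
    (lam : ℝ) (ν : Measure (ℕ → Fin a)) : Prop :=
  IsProbabilityMeasure ν ∧ ν (SFT A)ᶜ = 0 ∧
    ∀ g : (ℕ → Fin a) → ℝ, Continuous g →
      ∫ x, transfer A F g x ∂ν = lam * ∫ x, g x ∂ν

/-- The thermodynamic data on a subshift of finite type: for every Hölder continuous
potential `F`, the pressure `P F`, the Gibbs eigenmeasure `ν F` (the unique probability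
measure with `L_F^* ν = e^{P F} ν`) and the positive Hölder continuous eigenfunction
`φ F` with `L_F (φ F) = e^{P F} φ F`, `∫ φ F dν F = 1`. -/
structure GibbsData (a : ℕ) (A : Fin a → Fin a → Bool) where
  P : ((ℕ → Fin a) → ℝ) → ℝ
  ν : ((ℕ → Fin a) → ℝ) → Measure (ℕ → Fin a)
  φ : ((ℕ → Fin a) → ℝ) → (ℕ → Fin a) → ℝ
  eigen : ∀ F, HolderSeq F → Eigenmeasure A F (Real.exp (P F)) (ν F)
  unique : ∀ F, HolderSeq F → ∀ lam ν', Eigenmeasure A F lam ν' →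
    lam = Real.exp (P F) ∧ ν' = ν F
  φ_holder : ∀ F, HolderSeq F → HolderSeq (φ F)
  φ_pos : ∀ F, HolderSeq F → ∀ x ∈ SFT A, 0 < φ F x
  φ_eigen : ∀ F, HolderSeq F → ∀ x ∈ SFT A,
    transfer A F (φ F) x = Real.exp (P F) * φ F x
  φ_norm : ∀ F, HolderSeq F → ∫ x, φ F x ∂(ν F) = 1

/-- The shift-invariant Gibbs measure `μ_F = φ_F ν_F`. -/
noncomputable def GibbsData.μ {a : ℕ} {A : Fin a → Fin a → Bool} (G : GibbsData a A)
    (F : (ℕ → Fin a) → ℝ) : Measure (ℕ → Fin a) :=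
  (G.ν F).withDensity (fun x => ENNReal.ofReal (G.φ F x))

/-- The linearly parametrized potential `F_t = f₀ + ∑ i, t i • f i`. -/
def Fpot {a d : ℕ} (f₀ : (ℕ → Fin a) → ℝ) (f : Fin d → (ℕ → Fin a) → ℝ)
    (t : Fin d → ℝ) : (ℕ → Fin a) → ℝ :=
  fun x => f₀ x + ∑ i : Fin d, t i * f i x

/-- The vector `F⃗ = (f₀, f₁, …, f_d)`. -/
def Fvec {a d : ℕ} (f₀ : (ℕ → Fin a) → ℝ) (f : Fin d → (ℕ → Fin a) → ℝ) :
    Fin (d + 1) → (ℕ → Fin a) → ℝ :=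
  Fin.cons f₀ f

/-- `Covμ μ f g c` : the asymptotic covariance
`lim (1/m) ∫ S_m(f - ∫ f dμ) S_m(g - ∫ g dμ) dμ` exists and equals `c`. -/
def Covμ {a : ℕ} (μ : Measure (ℕ → Fin a)) (f g : (ℕ → Fin a) → ℝ) (c : ℝ) : Prop :=
  Tendsto (fun m : ℕ => (1 / (m : ℝ)) *
      ∫ x, birkhoff m (fun y => f y - ∫ z, f z ∂μ) x *
        birkhoff m (fun y => g y - ∫ z, g z ∂μ) x ∂μ)
    atTop (nhds c)

/-- `f` and `g` are cohomologous (on the subshift): `g - f = c + h - h∘σ`. -/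
def Cohomologous {a : ℕ} (A : Fin a → Fin a → Bool) (f g : (ℕ → Fin a) → ℝ) : Prop :=
  ∃ c : ℝ, ∃ h : (ℕ → Fin a) → ℝ, Continuous h ∧
    ∀ x ∈ SFT A, g x - f x = c + h x - h (shift x)

/-- `(f₁,…,f_d)` is linearly independent as cohomology classes. -/
def LinIndepCohom {a d : ℕ} (A : Fin a → Fin a → Bool)
    (f : Fin d → (ℕ → Fin a) → ℝ) : Prop :=
  ∀ s : Fin d → ℝ,
    Cohomologous A (fun _ => 0) (fun x => ∑ i : Fin d, s i * f i x) → s = 0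

/-- The supremum of the Birkhoff sum `S_n g` over the cylinder `[c₀,…,c_{n-1}]`. -/
noncomputable def supCyl {a : ℕ} (A : Fin a → Fin a → Bool) (n : ℕ)
    (g : (ℕ → Fin a) → ℝ) (c : ℕ → Fin a) : ℝ :=
  sSup (birkhoff n g '' cyl A n c)

/-- The constraint set `Θ_n^η(x)` of Definition 2.1. -/
noncomputable def ThetaSet {a d : ℕ} (A : Fin a → Fin a → Bool)
    (G : GibbsData a A) (f₀ : (ℕ → Fin a) → ℝ) (f : Fin d → (ℕ → Fin a) → ℝ)
    (Θ : Set (Fin d → ℝ)) (η : ℝ) (n : ℕ) (x : ℕ → Fin a) : Set (Fin d → ℝ) :=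
  {s ∈ Θ | (∀ i : Fin d, |s i| ≤ 1 / η) ∧
    ∀ i : Fin (d + 1),
      |(1 / (n : ℝ)) * supCyl A n (Fvec f₀ f i) x -
        ∫ z, Fvec f₀ f i z ∂(G.μ (Fpot f₀ f s))| ≤ η ^ 2}

/-- `est` is an `η`-maximum likelihood estimator at stage `n` for the data `x`:
it lies in `Θ_n^η(x)` and maximizes `s ↦ ν_s([x₀,…,x_{n-1}])` over `Θ_n^η(x)`. -/
def IsMLE {a d : ℕ} (A : Fin a → Fin a → Bool) (G : GibbsData a A)
    (f₀ : (ℕ → Fin a) → ℝ) (f : Fin d → (ℕ → Fin a) → ℝ) (Θ : Set (Fin d → ℝ))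
    (η : ℝ) (n : ℕ) (x : ℕ → Fin a) (est : Fin d → ℝ) : Prop :=
  est ∈ ThetaSet A G f₀ f Θ η n x ∧
    ∀ s ∈ ThetaSet A G f₀ f Θ η n x,
      G.ν (Fpot f₀ f s) (cyl A n x) ≤ G.ν (Fpot f₀ f est) (cyl A n x)

/-- Weak convergence of a sequence of measures, tested against bounded continuous
functions. -/
def WeakTendsto {E : Type*} [TopologicalSpace E] [MeasurableSpace E]
    (μs : ℕ → Measure E) (μ : Measure E) : Prop :=
  ∀ g : BoundedContinuousFunction E ℝ,
    Tendsto (fun n => ∫ x, g x ∂(μs n)) atTop (nhds (∫ x, g x ∂μ))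

/-- `γ` is the centered `d`-dimensional Gaussian distribution with covariance
matrix `Σ`, characterized through its one-dimensional projections. -/
def IsCenteredGaussian {d : ℕ} (S : Matrix (Fin d) (Fin d) ℝ)
    (γ : Measure (Fin d → ℝ)) : Prop :=
  IsProbabilityMeasure γ ∧
    ∀ l : Fin d → ℝ,
      γ.map (fun x => ∑ i : Fin d, l i * x i) =
        ProbabilityTheory.gaussianReal 0
          (∑ i : Fin d, ∑ j : Fin d, l i * S i j * l j).toNNReal

/-- The random matrix `G(M) = MᵗM − Σ` of Theorem 2.8. -/
noncomputable def Gmat {d : ℕ} (S : Matrix (Fin d) (Fin d) ℝ) (M : Fin d → ℝ) :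
    Matrix (Fin d) (Fin d) ℝ :=
  Matrix.vecMulVec M M - S

/-- The limiting random vector `G⁻¹(N)Nᵗ`. -/
noncomputable def limitVec {d : ℕ} (S : Matrix (Fin d) (Fin d) ℝ) (M : Fin d → ℝ) :
    Fin d → ℝ :=
  (Gmat S M)⁻¹.mulVec M

end GibbsPaper

namespace GibbsPaper

/-- The `i`-th partial logarithmic derivative `∂_i [log ν_s([x₀,…,x_{n−1}])](t)`,
as a function of the sample point `x`. -/
noncomputable def logDeriv {a d : ℕ} (A : Fin a → Fin a → Bool) (G : GibbsData a A)
    (f₀ : (ℕ → Fin a) → ℝ) (f : Fin d → (ℕ → Fin a) → ℝ) (t : Fin d → ℝ)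
    (i : Fin d) (n : ℕ) (x : ℕ → Fin a) : ℝ :=
  fderiv ℝ (fun s : Fin d → ℝ =>
    Real.log ((G.ν (Fpot f₀ f s) (cyl A n x)).toReal)) t (Pi.single i 1)

/-- A retraction of the full shift onto the subshift which reads sequences causally. -/
structure Retraction {a : ℕ} (A : Fin a → Fin a → Bool)
    (r : (ℕ → Fin a) → ℕ → Fin a) : Prop where
  mem : ∀ x, r x ∈ SFT A
  fixed : ∀ x ∈ SFT A, r x = x
  agree : ∀ (n : ℕ) (x y : ℕ → Fin a), (∀ i < n, x i = y i) → ∀ i < n, r x i = r y i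
  zero : ∀ x, r x 0 = x 0

/-- Copy a sequence as long as it is admissible, continuing along `sc` otherwise. -/
def retract {a : ℕ} (A : Fin a → Fin a → Bool) (sc : Fin a → Fin a) (x : ℕ → Fin a) :
    ℕ → Fin a
  | 0 => x 0
  | n + 1 => if A (retract A sc x n) (x (n + 1)) = true then x (n + 1)
      else sc (retract A sc x n)

theorem retraction_retract {a : ℕ} {A : Fin a → Fin a → Bool} {sc : Fin a → Fin a}
    (hsc : ∀ i, A i (sc i) = true) : Retraction A (retract A sc) where
  mem x n := by
    by_cases h : A (retract A sc x n) (x (n + 1)) = true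
    · simp [retract, h]
    · simp only [retract, h]
      exact hsc _
  fixed x hx := by
    funext n
    induction n with
    | zero => rfl
    | succ n ih => simp [retract, ih, hx n]
  agree n x y h i hi := by
    induction i with
    | zero => exact h 0 hi
    | succ i ih => simp only [retract, ih (by omega), h _ hi]
  zero _ := rfl

theorem Mixing.exists_retraction {a : ℕ} {A : Fin a → Fin a → Bool} (hmix : Mixing A) :
    ∃ r, Retraction A r := by
  obtain ⟨N, hN⟩ := hmix
  have h : ∀ i, ∃ j, A i j = true := fun i => by
    obtain ⟨w, h0, -, hw⟩ := hN (N + 1) (by omega) i i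
    exact ⟨w 1, h0 ▸ hw 0 (by omega)⟩
  choose sc hsc using h
  exact ⟨_, retraction_retract hsc⟩

@[simp] theorem shift_cons {a : ℕ} (i : Fin a) (x : ℕ → Fin a) : shift (cons i x) = x := rfl

theorem cons_shift {a : ℕ} (x : ℕ → Fin a) : cons (x 0) (shift x) = x := by
  funext n
  cases n <;> rfl

theorem iterate_shift_apply {a : ℕ} (n k : ℕ) (x : ℕ → Fin a) :
    shift^[n] x k = x (n + k) := by
  induction n generalizing k with
  | zero => simp
  | succ n ih =>
    rw [Function.iterate_succ_apply']
    change shift^[n] x (k + 1) = _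
    rw [ih]
    congr 1
    omega

theorem cons_mem_SFT {a : ℕ} {A : Fin a → Fin a → Bool} {i : Fin a} {x : ℕ → Fin a}
    (hx : x ∈ SFT A) (hi : A i (x 0) = true) : cons i x ∈ SFT A := by
  intro n
  cases n with
  | zero => exact hi
  | succ n => exact hx n

theorem shift_mem_SFT {a : ℕ} {A : Fin a → Fin a → Bool} {x : ℕ → Fin a}
    (hx : x ∈ SFT A) : shift x ∈ SFT A := fun n => hx (n + 1)

theorem iterate_shift_mem_SFT {a : ℕ} {A : Fin a → Fin a → Bool} {x : ℕ → Fin a}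
    (hx : x ∈ SFT A) (n : ℕ) : shift^[n] x ∈ SFT A := by
  induction n with
  | zero => exact hx
  | succ n ih =>
    rw [Function.iterate_succ_apply']
    exact shift_mem_SFT ih

theorem cons_agree {a : ℕ} {n : ℕ} (i : Fin a) {x y : ℕ → Fin a}
    (h : ∀ k < n, x k = y k) : ∀ k < n + 1, cons i x k = cons i y k := by
  intro k hk
  cases k with
  | zero => rfl
  | succ k => exact h k (by omega)

theorem iterate_shift_agree {a : ℕ} {n k : ℕ} {x y : ℕ → Fin a}
    (h : ∀ i < n, x i = y i) : ∀ i < n - k, shift^[k] x i = shift^[k] y i := by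
  intro i hi
  rw [iterate_shift_apply, iterate_shift_apply]
  exact h _ (by omega)

/-- The statement that any two symbols are joined by an admissible path of length `N`. -/
def Connects {a : ℕ} (A : Fin a → Fin a → Bool) (N : ℕ) : Prop :=
  ∀ i j : Fin a, ∃ w : ℕ → Fin a,
    w 0 = i ∧ w N = j ∧ ∀ k < N, A (w k) (w (k + 1)) = true

theorem Connects.exists_preimage {a : ℕ} {A : Fin a → Fin a → Bool} {N : ℕ}
    (hN : Connects A N) {b x : ℕ → Fin a} (hb : b ∈ SFT A) (hx : x ∈ SFT A) (p : ℕ) :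
    ∃ z ∈ SFT A, shift^[p + N] z = x ∧ ∀ i ≤ p, z i = b i := by
  obtain ⟨w, h0, h1, hw⟩ := hN (b p) (x 0)
  let z : ℕ → Fin a := fun i =>
    if i < p then b i else if i < p + N then w (i - p) else x (i - (p + N))
  have zb : ∀ i ≤ p, z i = b i := by
    intro i hi
    rcases hi.lt_or_eq with h | rfl
    · simp [z, h]
    · rcases Nat.eq_zero_or_pos N with rfl | hp
      · simp [z, ← h1, h0]
      · simp [z, hp, h0]
  have zw : ∀ k ≤ N, z (p + k) = w k := by
    intro k hk
    rcases hk.lt_or_eq with h | rfl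
    · simp [z, h]
    · simp [z, h1]
  have zx : ∀ k, z (p + N + k) = x k := by
    intro k
    simp only [z]
    rw [if_neg (by omega), if_neg (by omega)]
    congr 1
    omega
  refine ⟨z, fun n => ?_, ?_, zb⟩
  · rcases lt_or_ge n p with h | h
    · rw [zb n h.le, zb (n + 1) h]
      exact hb n
    · rcases lt_or_ge n (p + N) with h' | h'
      · obtain ⟨k, rfl⟩ := Nat.exists_eq_add_of_le h
        rw [zw k (by omega), add_assoc, zw (k + 1) (by omega)]
        exact hw k (by omega)
      · obtain ⟨k, rfl⟩ := Nat.exists_eq_add_of_le h'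
        rw [zx k, add_assoc, zx (k + 1)]
        exact hx k
  · funext k
    rw [iterate_shift_apply, zx]

/-- `g` is Hölder continuous with constant `C` with respect to the metric `ρ ^ n`. -/
def HolWith {a : ℕ} (ρ C : ℝ) (g : (ℕ → Fin a) → ℝ) : Prop :=
  ∀ (n : ℕ) (x y : ℕ → Fin a), (∀ i < n, x i = y i) → |g x - g y| ≤ C * ρ ^ n

/-- `g` is Hölder continuous with respect to the metric `ρ ^ n`. -/
def Hol {a : ℕ} (ρ : ℝ) (g : (ℕ → Fin a) → ℝ) : Prop := ∃ C, 0 ≤ C ∧ HolWith ρ C g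

theorem eventually_agree {a : ℕ} (x : ℕ → Fin a) (n : ℕ) :
    ∀ᶠ y in nhds x, ∀ i < n, y i = x i := by
  have : ∀ᶠ y in nhds x, ∀ i ∈ Finset.range n, y i = x i := by
    refine (Filter.eventually_all_finset _).2 fun i _ => ?_
    have hc : ContinuousAt (fun y : ℕ → Fin a => y i) x := (continuous_apply i).continuousAt
    exact hc.eventually (p := fun b => b = x i) (mem_nhds_discrete.2 rfl)
  filter_upwards [this] with y hy i hi using hy i (Finset.mem_range.2 hi)

theorem continuous_of_forall_agree {a : ℕ} {β : Type*} [TopologicalSpace β]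
    {g : (ℕ → Fin a) → β} (n : ℕ) (h : ∀ x y, (∀ i < n, x i = y i) → g x = g y) :
    Continuous g := by
  refine continuous_iff_continuousAt.2 fun x => ?_
  refine (continuousAt_const (y := g x)).congr ?_
  filter_upwards [eventually_agree x n] with y hy using (h y x hy).symm

theorem HolWith.mono {a : ℕ} {ρ C C' : ℝ} {g : (ℕ → Fin a) → ℝ} (hg : HolWith ρ C g)
    (hρ : 0 ≤ ρ) (hC : C ≤ C') : HolWith ρ C' g := fun n x y h =>
  (hg n x y h).trans (by gcongr)

theorem HolWith.continuous {a : ℕ} {ρ C : ℝ} {g : (ℕ → Fin a) → ℝ} (hg : HolWith ρ C g)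
    (h0 : 0 ≤ ρ) (h1 : ρ < 1) : Continuous g := by
  refine continuous_iff_continuousAt.2 fun x => ?_
  rw [ContinuousAt, tendsto_iff_dist_tendsto_zero]
  rw [Metric.tendsto_nhds]
  intro ε hε
  have hlim : Tendsto (fun n : ℕ => C * ρ ^ n) atTop (nhds (C * 0)) :=
    (tendsto_pow_atTop_nhds_zero_of_lt_one h0 h1).const_mul C
  rw [mul_zero] at hlim
  obtain ⟨n, hn⟩ := (hlim.eventually (gt_mem_nhds hε)).exists
  filter_upwards [eventually_agree x n] with y hy
  rw [dist_zero_right, Real.norm_of_nonneg dist_nonneg, Real.dist_eq]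
  exact (hg n y x hy).trans_lt hn

theorem HolWith.mul {a : ℕ} {ρ B B' C D : ℝ} {g h : (ℕ → Fin a) → ℝ} (hg : HolWith ρ C g)
    (h0 : 0 ≤ ρ) (hC : 0 ≤ C) (hh : HolWith ρ D h) (hgB : ∀ x, |g x| ≤ B)
    (hhB : ∀ x, |h x| ≤ B') : HolWith ρ (C * B' + B * D) (fun x => g x * h x) := by
  intro n x y hxy
  have hB : 0 ≤ B := (abs_nonneg _).trans (hgB x)
  have e : g x * h x - g y * h y = (g x - g y) * h x + g y * (h x - h y) := by ring
  rw [e]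
  refine (abs_add_le _ _).trans ?_
  rw [abs_mul, abs_mul]
  calc _ ≤ C * ρ ^ n * B' + B * (D * ρ ^ n) := by
        gcongr
        exacts [hg n x y hxy, hhB x, hgB y, hh n x y hxy]
    _ = _ := by ring

namespace Hol

variable {a : ℕ} {ρ : ℝ} {g h : (ℕ → Fin a) → ℝ}

theorem continuous (hg : Hol ρ g) (h0 : 0 ≤ ρ) (h1 : ρ < 1) : Continuous g :=
  hg.choose_spec.2.continuous h0 h1

theorem const (ρ : ℝ) (c : ℝ) : Hol ρ (fun _ : ℕ → Fin a => c) :=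
  ⟨0, le_rfl, fun n x y _ => by simp⟩

theorem of_agree (h0 : 0 < ρ) (h1 : ρ ≤ 1) {B : ℝ} (hB : ∀ x, |g x| ≤ B) (m : ℕ)
    (h : ∀ x y, (∀ i < m, x i = y i) → g x = g y) : Hol ρ g := by
  rcases isEmpty_or_nonempty (ℕ → Fin a) with he | ⟨⟨z⟩⟩
  · exact ⟨0, le_rfl, fun n x => he.elim x⟩
  have hB0 : 0 ≤ B := (abs_nonneg _).trans (hB z)
  refine ⟨2 * B / ρ ^ m, by positivity, fun n x y hxy => ?_⟩
  rcases le_or_gt m n with hmn | hmn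
  · rw [h x y fun i hi => hxy i (by omega), sub_self, abs_zero]
    positivity
  · have h2 : ρ ^ m ≤ ρ ^ n := pow_le_pow_of_le_one h0.le h1 hmn.le
    calc |g x - g y| ≤ |g x| + |g y| := abs_sub _ _
      _ ≤ 2 * B := by linarith [hB x, hB y]
      _ = 2 * B / ρ ^ m * ρ ^ m := by field_simp
      _ ≤ _ := by gcongr

theorem bounded (hg : Hol ρ g) : ∃ B, 0 < B ∧ ∀ x, |g x| ≤ B := by
  obtain ⟨C, hC, hg⟩ := hg
  rcases isEmpty_or_nonempty (ℕ → Fin a) with he | ⟨⟨z⟩⟩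
  · exact ⟨1, one_pos, fun x => he.elim x⟩
  refine ⟨C + |g z| + 1, by positivity, fun x => ?_⟩
  have := hg 0 x z (by simp)
  have h2 : |g x| ≤ |g x - g z| + |g z| := by
    simpa using abs_add_le (g x - g z) (g z)
  simp only [pow_zero, mul_one] at this
  linarith

theorem add (hg : Hol ρ g) (hh : Hol ρ h) : Hol ρ (fun x => g x + h x) := by
  obtain ⟨C, hC, hg⟩ := hg
  obtain ⟨D, hD, hh⟩ := hh
  refine ⟨C + D, by positivity, fun n x y hxy => ?_⟩
  have e : g x + h x - (g y + h y) = (g x - g y) + (h x - h y) := by ring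
  rw [e, add_mul]
  exact (abs_add_le _ _).trans (add_le_add (hg n x y hxy) (hh n x y hxy))

theorem mul (h0 : 0 ≤ ρ) (hg : Hol ρ g) (hh : Hol ρ h) : Hol ρ (fun x => g x * h x) := by
  obtain ⟨B, hB, hgB⟩ := hg.bounded
  obtain ⟨B', hB', hhB⟩ := hh.bounded
  obtain ⟨C, hC, hg⟩ := hg
  obtain ⟨D, hD, hh⟩ := hh
  exact ⟨C * B' + B * D, by positivity, hg.mul h0 hC hh hgB hhB⟩

theorem const_mul (h0 : 0 ≤ ρ) (c : ℝ) (hg : Hol ρ g) : Hol ρ (fun x => c * g x) :=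
  (Hol.const ρ c).mul h0 hg

theorem sub (h0 : 0 ≤ ρ) (hg : Hol ρ g) (hh : Hol ρ h) : Hol ρ (fun x => g x - h x) := by
  simpa [sub_eq_add_neg] using hg.add (hh.const_mul h0 (-1))

theorem sum {ι : Type*} (s : Finset ι) {u : ι → (ℕ → Fin a) → ℝ}
    (hu : ∀ i ∈ s, Hol ρ (u i)) : Hol ρ (fun x => ∑ i ∈ s, u i x) := by
  classical
  induction s using Finset.induction_on with
  | empty => simpa using Hol.const ρ 0
  | insert i s hi ih =>
    simp only [Finset.sum_insert hi]
    exact (hu i (by simp)).add (ih fun j hj => hu j (by simp [hj]))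

theorem exp (hg : Hol ρ g) : Hol ρ (fun x => Real.exp (g x)) := by
  obtain ⟨B, hB, hgB⟩ := hg.bounded
  obtain ⟨C, hC, hg⟩ := hg
  have key : ∀ u v : ℝ, |u| ≤ B → Real.exp u - Real.exp v ≤ Real.exp B * |u - v| := by
    intro u v hu
    have h1 : u - v + 1 ≤ |u - v| + 1 := by linarith [le_abs_self (u - v)]
    have h2 : Real.exp v = Real.exp u * Real.exp (v - u) := by
      rw [← Real.exp_add]; congr 1; ring
    have h3 := Real.add_one_le_exp (v - u)
    have h4 : Real.exp u ≤ Real.exp B := Real.exp_le_exp.2 ((le_abs_self u).trans hu)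
    calc Real.exp u - Real.exp v = Real.exp u * (1 - Real.exp (v - u)) := by rw [h2]; ring
      _ ≤ Real.exp u * |u - v| := by
          gcongr
          linarith
      _ ≤ _ := by gcongr
  refine ⟨Real.exp B * C, by positivity, fun n x y hxy => ?_⟩
  have h1 := key (g x) (g y) (hgB x)
  have h2 := key (g y) (g x) (hgB y)
  rw [abs_sub_comm (g y)] at h2
  have h3 : Real.exp B * |g x - g y| ≤ Real.exp B * (C * ρ ^ n) := by
    gcongr
    exact hg n x y hxy
  rw [abs_le, mul_assoc]
  constructor <;> linarith

theorem inv {c : ℝ} (hc : 0 < c) (hg : Hol ρ g) (hgc : ∀ x, c ≤ g x) :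
    Hol ρ (fun x => (g x)⁻¹) := by
  obtain ⟨C, hC, hg⟩ := hg
  refine ⟨C / (c * c), by positivity, fun n x y hxy => ?_⟩
  have hx := hc.trans_le (hgc x)
  have hy := hc.trans_le (hgc y)
  have e : (g x)⁻¹ - (g y)⁻¹ = (g y - g x) / (g x * g y) := by field_simp
  rw [e, abs_div, abs_sub_comm, abs_of_pos (mul_pos hx hy), div_mul_eq_mul_div]
  gcongr
  exacts [(abs_nonneg _).trans (hg n x y hxy), hg n x y hxy, hgc x, hgc y]

theorem comp_of_agree (hg : Hol ρ g) {T : (ℕ → Fin a) → ℕ → Fin a}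
    (hT : ∀ (n : ℕ) (x y : ℕ → Fin a), (∀ i < n, x i = y i) → ∀ i < n, T x i = T y i) :
    Hol ρ (fun x => g (T x)) := by
  obtain ⟨C, hC, hg⟩ := hg
  exact ⟨C, hC, fun n x y hxy => hg n _ _ (hT n x y hxy)⟩

theorem comp_cons (hg : Hol ρ g) (i : Fin a) : Hol ρ (fun x => g (cons i x)) :=
  hg.comp_of_agree fun n _ _ h k hk => cons_agree i h k (by omega)

theorem mono {ρ' : ℝ} (hg : Hol ρ g) (h0 : 0 ≤ ρ) (h : ρ ≤ ρ') : Hol ρ' g := by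
  obtain ⟨C, hC, hg⟩ := hg
  exact ⟨C, hC, fun n x y hxy => (hg n x y hxy).trans (by gcongr)⟩

end Hol

theorem HolderSeq.exists_hol {a : ℕ} {g : (ℕ → Fin a) → ℝ} (hg : HolderSeq g) :
    ∃ ρ, 0 < ρ ∧ ρ < 1 ∧ Hol ρ g := by
  obtain ⟨-, C, ρ, h0, h1, h⟩ := hg
  refine ⟨ρ, h0, h1, |C|, abs_nonneg _, fun n x y hxy => (h n x y hxy).trans ?_⟩
  gcongr
  exact le_abs_self C

theorem exists_common_hol {a : ℕ} {ι : Type*} [Finite ι] {u : ι → (ℕ → Fin a) → ℝ}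
    (hu : ∀ i, HolderSeq (u i)) : ∃ ρ, 0 < ρ ∧ ρ < 1 ∧ ∀ i, Hol ρ (u i) := by
  choose ρ h0 h1 h using fun i => (hu i).exists_hol
  rcases isEmpty_or_nonempty ι with he | hne
  · exact ⟨1 / 2, by norm_num, by norm_num, fun i => he.elim i⟩
  · obtain ⟨i, hi⟩ := Finite.exists_max ρ
    exact ⟨ρ i, h0 i, h1 i, fun j => (h j).mono (h0 j).le (hi j)⟩

/-- The operator `g ↦ ∑ i, q i (r x) * g (cons i (r x))` with branch weights `q`. -/
def branchOp {a : ℕ} (r : (ℕ → Fin a) → ℕ → Fin a) (q : Fin a → (ℕ → Fin a) → ℝ)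
    (g : (ℕ → Fin a) → ℝ) (x : ℕ → Fin a) : ℝ :=
  ∑ i, q i (r x) * g (cons i (r x))

section BranchOp

variable {a : ℕ} {A : Fin a → Fin a → Bool} {r : (ℕ → Fin a) → ℕ → Fin a}
  {q : Fin a → (ℕ → Fin a) → ℝ} {ρ δ : ℝ}

theorem Retraction.idem (hr : Retraction A r) (x : ℕ → Fin a) : r (r x) = r x :=
  hr.fixed _ (hr.mem x)

theorem branchOp_retraction (hr : Retraction A r) (g : (ℕ → Fin a) → ℝ) (x : ℕ → Fin a) :
    branchOp r q g (r x) = branchOp r q g x := by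
  simp only [branchOp, hr.idem]

theorem branchOp_congr (hr : Retraction A r)
    (hqA : ∀ i x, A i (x 0) ≠ true → q i x = 0) {g g' : (ℕ → Fin a) → ℝ}
    (h : ∀ x ∈ SFT A, g x = g' x) (x : ℕ → Fin a) : branchOp r q g x = branchOp r q g' x := by
  refine Finset.sum_congr rfl fun i _ => ?_
  by_cases hi : A i (r x 0) = true
  · rw [h _ (cons_mem_SFT (hr.mem x) hi)]
  · rw [hqA i _ hi, zero_mul, zero_mul]

theorem branchOp_add (g h : (ℕ → Fin a) → ℝ) :
    branchOp r q (fun x => g x + h x) = fun x => branchOp r q g x + branchOp r q h x := by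
  funext x
  simp only [branchOp, mul_add, Finset.sum_add_distrib]

theorem branchOp_sub (g h : (ℕ → Fin a) → ℝ) :
    branchOp r q (fun x => g x - h x) = fun x => branchOp r q g x - branchOp r q h x := by
  funext x
  simp only [branchOp, mul_sub, Finset.sum_sub_distrib]

theorem branchOp_sum {ι : Type*} (s : Finset ι) (u : ι → (ℕ → Fin a) → ℝ) (x : ℕ → Fin a) :
    branchOp r q (fun x => ∑ k ∈ s, u k x) x = ∑ k ∈ s, branchOp r q (u k) x := by
  simp only [branchOp, Finset.mul_sum]
  exact Finset.sum_comm

theorem Hol.branchOp (hr : Retraction A r) (h0 : 0 ≤ ρ) (hq : ∀ i, Hol ρ (q i))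
    {g : (ℕ → Fin a) → ℝ} (hg : Hol ρ g) : Hol ρ (branchOp r q g) :=
  Hol.sum _ fun i _ => ((hq i).comp_of_agree hr.agree).mul h0
    ((hg.comp_cons i).comp_of_agree hr.agree)

theorem Hol.iterate_branchOp (hr : Retraction A r) (h0 : 0 ≤ ρ) (hq : ∀ i, Hol ρ (q i))
    {g : (ℕ → Fin a) → ℝ} (hg : Hol ρ g) (n : ℕ) :
    Hol ρ ((GibbsPaper.branchOp r q)^[n] g) := by
  induction n with
  | zero => exact hg
  | succ n ih =>
    rw [Function.iterate_succ_apply']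
    exact ih.branchOp hr h0 hq

theorem branchOp_nonneg (hq : ∀ i x, 0 ≤ q i x) {g : (ℕ → Fin a) → ℝ}
    (hg : ∀ x, 0 ≤ g x) (x : ℕ → Fin a) : 0 ≤ branchOp r q g x :=
  Finset.sum_nonneg fun _ _ => mul_nonneg (hq _ _) (hg _)

theorem iterate_branchOp_nonneg (hq : ∀ i x, 0 ≤ q i x) {g : (ℕ → Fin a) → ℝ}
    (hg : ∀ x, 0 ≤ g x) (n : ℕ) (x : ℕ → Fin a) : 0 ≤ (branchOp r q)^[n] g x := by
  induction n generalizing x with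
  | zero => exact hg x
  | succ n ih =>
    rw [Function.iterate_succ_apply']
    exact branchOp_nonneg hq ih x

theorem pow_mul_le_iterate_branchOp (hr : Retraction A r) (hq : ∀ i x, 0 ≤ q i x)
    (hδ0 : 0 ≤ δ) (hδ : ∀ i, ∀ x ∈ SFT A, A i (x 0) = true → δ ≤ q i x)
    {g : (ℕ → Fin a) → ℝ} (hg : ∀ x, 0 ≤ g x) (m : ℕ) {z : ℕ → Fin a} (hz : z ∈ SFT A) :
    δ ^ m * g z ≤ (branchOp r q)^[m] g (shift^[m] z) := by
  induction m with
  | zero => simp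
  | succ m ih =>
    rw [Function.iterate_succ_apply', Function.iterate_succ_apply']
    set y := shift^[m] z
    have hy : y ∈ SFT A := iterate_shift_mem_SFT hz m
    have hy' := shift_mem_SFT hy
    have h1 : q (y 0) (shift y) * (branchOp r q)^[m] g (cons (y 0) (shift y)) ≤
        branchOp r q ((branchOp r q)^[m] g) (shift y) := by
      rw [branchOp, hr.fixed _ hy']
      exact Finset.single_le_sum (f := fun i => q i (shift y) *
        (branchOp r q)^[m] g (cons i (shift y)))
        (fun i _ => mul_nonneg (hq _ _) (iterate_branchOp_nonneg hq hg _ _)) (Finset.mem_univ _)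
    rw [cons_shift] at h1
    refine le_trans ?_ h1
    rw [pow_succ', mul_assoc]
    exact mul_le_mul (hδ _ _ hy' (hy 0)) ih (mul_nonneg (pow_nonneg hδ0 _) (hg _)) (hq _ _)

/-- Functions of oscillation at most `D` and Hölder seminorm at most `M * D`. -/
def InBall {a : ℕ} (ρ M D : ℝ) (g : (ℕ → Fin a) → ℝ) : Prop :=
  (∀ x y, g x - g y ≤ D) ∧
    ∀ (n : ℕ) (x y : ℕ → Fin a), (∀ i < n + 1, x i = y i) → |g x - g y| ≤ M * D * ρ ^ n

theorem InBall.mono {M D D' : ℝ} {g : (ℕ → Fin a) → ℝ} (h : InBall ρ M D g) (h0 : 0 ≤ ρ)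
    (hM : 0 ≤ M) (hD : D ≤ D') : InBall ρ M D' g :=
  ⟨fun x y => (h.1 x y).trans hD, fun n x y hxy => (h.2 n x y hxy).trans (by gcongr)⟩

theorem exists_lower_bound_of_oscillation {X : Type*} {g : X → ℝ} {D : ℝ}
    (h : ∀ x y, g x - g y ≤ D) : ∃ lo, ∀ x, lo ≤ g x ∧ g x ≤ lo + D := by
  rcases isEmpty_or_nonempty X with he | hne
  · exact ⟨0, fun x => he.elim x⟩
  refine ⟨⨅ x, g x, fun x => ⟨ciInf_le ⟨g x - D, ?_⟩ x, ?_⟩⟩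
  · rintro _ ⟨y, rfl⟩
    have := h x y
    linarith
  · have : g x - D ≤ ⨅ x, g x := le_ciInf fun y => by have := h x y; linarith
    linarith

/-- Branch weights of a Markov operator on the subshift. -/
structure MarkovWeights {a : ℕ} (A : Fin a → Fin a → Bool) (ρ δ : ℝ)
    (q : Fin a → (ℕ → Fin a) → ℝ) : Prop where
  nonneg : ∀ i x, 0 ≤ q i x
  hol : ∀ i, Hol ρ (q i)
  pos : 0 < δ
  le : ∀ i, ∀ x ∈ SFT A, A i (x 0) = true → δ ≤ q i x
  sum_eq_one : ∀ x ∈ SFT A, ∑ i, q i x = 1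

namespace MarkovWeights

theorem branchOp_const (hq : MarkovWeights A ρ δ q) (hr : Retraction A r) (c : ℝ) :
    branchOp r q (fun _ => c) = fun _ => c := by
  funext x
  rw [branchOp, ← Finset.sum_mul, hq.sum_eq_one _ (hr.mem x), one_mul]

theorem iterate_const_sub (hq : MarkovWeights A ρ δ q) (hr : Retraction A r) (c : ℝ)
    (g : (ℕ → Fin a) → ℝ) (m : ℕ) :
    (branchOp r q)^[m] (fun x => c - g x) = fun x => c - (branchOp r q)^[m] g x := by
  induction m with
  | zero => rfl
  | succ m ih =>
    rw [Function.iterate_succ_apply', ih, branchOp_sub, hq.branchOp_const hr,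
      Function.iterate_succ_apply']

theorem iterate_sub_const (hq : MarkovWeights A ρ δ q) (hr : Retraction A r) (c : ℝ)
    (g : (ℕ → Fin a) → ℝ) (m : ℕ) :
    (branchOp r q)^[m] (fun x => g x - c) = fun x => (branchOp r q)^[m] g x - c := by
  induction m with
  | zero => rfl
  | succ m ih =>
    rw [Function.iterate_succ_apply', ih, branchOp_sub, hq.branchOp_const hr,
      Function.iterate_succ_apply']

theorem oscillation_branchOp (hq : MarkovWeights A ρ δ q) (hr : Retraction A r) {D : ℝ}
    {g : (ℕ → Fin a) → ℝ} (hg : ∀ x y, g x - g y ≤ D) (x y : ℕ → Fin a) :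
    branchOp r q g x - branchOp r q g y ≤ D := by
  obtain ⟨lo, hlo⟩ := exists_lower_bound_of_oscillation hg
  have h1 := branchOp_nonneg (r := r) hq.nonneg (g := fun x => g x - lo)
    (fun x => sub_nonneg.2 (hlo x).1) y
  have h2 := branchOp_nonneg (r := r) hq.nonneg (g := fun x => lo + D - g x)
    (fun x => sub_nonneg.2 (hlo x).2) x
  rw [branchOp_sub, hq.branchOp_const hr] at h1 h2
  linarith

theorem variation_branchOp (hq : MarkovWeights A ρ δ q) (hr : Retraction A r)
    (h0 : 0 ≤ ρ) (h1 : ρ ≤ 1) {C : ℝ} (hC0 : 0 ≤ C) (hC : ∀ i, HolWith ρ C (q i)) {K D : ℝ}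
    {g : (ℕ → Fin a) → ℝ} (hgD : ∀ x y, g x - g y ≤ D)
    (hgK : ∀ (n : ℕ) (x y : ℕ → Fin a), (∀ i < n + 1, x i = y i) → |g x - g y| ≤ K * ρ ^ n)
    (n : ℕ) (x y : ℕ → Fin a) (hxy : ∀ i < n + 1, x i = y i) :
    |branchOp r q g x - branchOp r q g y| ≤ (ρ * K + a * C * D) * ρ ^ n := by
  have hr' := hr.agree _ _ _ hxy
  have e : branchOp r q g x - branchOp r q g y =
      ∑ i, q i (r x) * (g (cons i (r x)) - g (cons i (r y))) +
      ∑ i, (q i (r x) - q i (r y)) * (g (cons i (r y)) - g y) := by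
    have hs : ∑ i, (q i (r x) - q i (r y)) = 0 := by
      rw [Finset.sum_sub_distrib, hq.sum_eq_one _ (hr.mem x), hq.sum_eq_one _ (hr.mem y),
        sub_self]
    simp only [mul_sub, sub_mul, Finset.sum_sub_distrib, ← Finset.sum_mul, branchOp]
    rw [hq.sum_eq_one _ (hr.mem x), hq.sum_eq_one _ (hr.mem y)]
    ring
  have b1 : |∑ i, q i (r x) * (g (cons i (r x)) - g (cons i (r y)))| ≤ K * ρ ^ (n + 1) := by
    refine (Finset.abs_sum_le_sum_abs _ _).trans ?_
    calc _ ≤ ∑ i, q i (r x) * (K * ρ ^ (n + 1)) := by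
          refine Finset.sum_le_sum fun i _ => ?_
          rw [abs_mul, abs_of_nonneg (hq.nonneg _ _)]
          exact mul_le_mul_of_nonneg_left (hgK _ _ _ (cons_agree i hr')) (hq.nonneg _ _)
      _ = _ := by rw [← Finset.sum_mul, hq.sum_eq_one _ (hr.mem x), one_mul]
  have b2 : |∑ i, (q i (r x) - q i (r y)) * (g (cons i (r y)) - g y)| ≤
      a * (C * ρ ^ n * D) := by
    refine (Finset.abs_sum_le_sum_abs _ _).trans ?_
    refine (Finset.sum_le_card_nsmul _ _ (C * ρ ^ n * D) fun i _ => ?_).trans (by simp)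
    rw [abs_mul]
    refine mul_le_mul (((hC i) (n + 1) _ _ hr').trans ?_)
      (abs_le.2 ⟨by linarith [hgD y (cons i (r y))], hgD _ _⟩) (abs_nonneg _) (by positivity)
    exact mul_le_mul_of_nonneg_left (pow_le_pow_of_le_one h0 h1 n.le_succ) hC0
  rw [e]
  refine (abs_add_le _ _).trans ((add_le_add b1 b2).trans_eq ?_)
  ring

theorem exists_contraction (hq : MarkovWeights A ρ δ q) (hr : Retraction A r)
    (h0 : 0 < ρ) (h1 : ρ < 1) {N : ℕ} (hN : Connects A N) :
    ∃ M : ℝ, 1 ≤ M ∧ ∃ m : ℕ, 0 < m ∧ ∃ κ : ℝ, 0 < κ ∧ κ < 1 ∧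
      ∀ (D : ℝ) (g : (ℕ → Fin a) → ℝ), 0 ≤ D → InBall ρ M D g →
        InBall ρ M D (branchOp r q g) ∧ InBall ρ M (κ * D) ((branchOp r q)^[m] g) := by
  obtain ⟨C, hC0, hC⟩ : ∃ C, 0 ≤ C ∧ ∀ i, HolWith ρ C (q i) := by
    choose C hC0 hC using hq.hol
    exact ⟨∑ i, C i, Finset.sum_nonneg fun i _ => hC0 i, fun i => (hC i).mono h0.le
      (Finset.single_le_sum (fun i _ => hC0 i) (Finset.mem_univ i))⟩
  have h1' : 0 < 1 - ρ := by linarith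
  set E := a * C / (1 - ρ) with hE
  have hE0 : 0 ≤ E := by positivity
  have hEeq : ρ * E + a * C = E := by
    rw [hE]; field_simp; ring
  set M := 4 * E + 1 with hM
  have hM0 : 1 ≤ M := by linarith
  obtain ⟨p, hp⟩ : ∃ p : ℕ, M * ρ ^ p ≤ 1 / 2 := by
    have : Tendsto (fun n : ℕ => M * ρ ^ n) atTop (nhds (M * 0)) :=
      (tendsto_pow_atTop_nhds_zero_of_lt_one h0.le h1).const_mul M
    rw [mul_zero] at this
    exact ((this.eventually (gt_mem_nhds (by norm_num : (0 : ℝ) < 1 / 2))).exists).imp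
      fun n hn => hn.le
  set m := p + 1 + N with hm
  have step : ∀ (D : ℝ) (g : (ℕ → Fin a) → ℝ), 0 ≤ D → InBall ρ M D g →
      ∀ k, (∀ x y, (branchOp r q)^[k] g x - (branchOp r q)^[k] g y ≤ D) ∧
        ∀ (n : ℕ) (x y : ℕ → Fin a), (∀ i < n + 1, x i = y i) →
          |(branchOp r q)^[k] g x - (branchOp r q)^[k] g y| ≤
            ((E + ρ ^ k * M) * D) * ρ ^ n := by
    intro D g hD hg k
    induction k with
    | zero =>
      refine ⟨hg.1, fun n x y hxy => (hg.2 n x y hxy).trans ?_⟩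
      rw [pow_zero, one_mul]
      gcongr
      linarith
    | succ k ih =>
      rw [Function.iterate_succ_apply']
      refine ⟨hq.oscillation_branchOp hr ih.1, fun n x y hxy => ?_⟩
      refine (hq.variation_branchOp hr h0.le h1.le hC0 hC ih.1 ih.2 n x y hxy).trans_eq ?_
      rw [pow_succ]
      linear_combination (D * ρ ^ n) * hEeq
  have hδ1 : 0 < δ ^ m := pow_pos hq.pos m
  refine ⟨M, hM0, m, by omega, max (1 - δ ^ m / 2) (3 / 4),
    lt_max_of_lt_right (by norm_num), max_lt (by linarith) (by norm_num), fun D g hD hg => ?_⟩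
  constructor
  · refine ⟨hq.oscillation_branchOp hr hg.1, fun n x y hxy =>
      (hq.variation_branchOp hr h0.le h1.le hC0 hC hg.1 hg.2 n x y hxy).trans ?_⟩
    have : ρ * (M * D) + a * C * D ≤ M * D := by
      have h2 : (ρ * M + a * C) ≤ M := by
        rw [hM]
        have : (ρ * E + a * C) * 1 = E := by linarith
        nlinarith [mul_nonneg h1'.le hE0]
      calc _ = (ρ * M + a * C) * D := by ring
        _ ≤ _ := by gcongr
    gcongr
  · constructor
    · intro x y
      obtain ⟨lo, hlo⟩ := exists_lower_bound_of_oscillation hg.1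
      obtain ⟨z, hz, hzx, hzb⟩ := hN.exists_preimage (hr.mem x) (hr.mem x) (p + 1)
      obtain ⟨z', hz', hzy, hzb'⟩ := hN.exists_preimage (hr.mem x) (hr.mem y) (p + 1)
      rw [← hm] at hzx hzy
      have l1 := pow_mul_le_iterate_branchOp hr hq.nonneg hq.pos.le hq.le
        (g := fun x => lo + D - g x) (fun x => sub_nonneg.2 (hlo x).2) m hz
      have l2 := pow_mul_le_iterate_branchOp hr hq.nonneg hq.pos.le hq.le
        (g := fun x => g x - lo) (fun x => sub_nonneg.2 (hlo x).1) m hz'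
      rw [hq.iterate_const_sub hr, hzx] at l1
      rw [hq.iterate_sub_const hr, hzy] at l2
      have hretr : ∀ x, (branchOp r q)^[m] g (r x) = (branchOp r q)^[m] g x := by
        intro x
        rw [hm, add_right_comm, Function.iterate_succ_apply', branchOp_retraction hr]
      simp only [hretr] at l1 l2
      have hv := (le_abs_self _).trans (hg.2 p z z' fun i hi => by
        rw [hzb i (by omega), hzb' i (by omega)])
      have hv' : g z - g z' ≤ D / 2 := by
        calc _ ≤ _ := hv
          _ = M * ρ ^ p * D := by ring
          _ ≤ 1 / 2 * D := by gcongr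
          _ = _ := by ring
      have hfin : (branchOp r q)^[m] g x - (branchOp r q)^[m] g y ≤ (1 - δ ^ m / 2) * D := by
        have := mul_le_mul_of_nonneg_left hv' hδ1.le
        nlinarith
      exact hfin.trans (mul_le_mul_of_nonneg_right (le_max_left _ _) hD)
    · intro n x y hxy
      refine ((step D g hD hg m).2 n x y hxy).trans ?_
      have h2 : ρ ^ m * M ≤ 1 / 2 := by
        refine le_trans ?_ hp
        rw [mul_comm]
        exact mul_le_mul_of_nonneg_left (pow_le_pow_of_le_one h0.le h1.le (by omega))
          (by linarith)
      have h3 : ρ ^ m ≤ 1 / 2 := by nlinarith [pow_pos h0 m]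
      have h4 : E + ρ ^ m * M ≤ max (1 - δ ^ m / 2) (3 / 4) * M := by
        have := mul_le_mul_of_nonneg_right (le_max_right (1 - δ ^ m / 2) (3 / 4))
          (by linarith : 0 ≤ M)
        nlinarith
      calc _ ≤ (max (1 - δ ^ m / 2) (3 / 4) * M) * D * ρ ^ n := by gcongr
        _ = _ := by ring

theorem exists_geometric_contraction (hq : MarkovWeights A ρ δ q) (hr : Retraction A r)
    (h0 : 0 < ρ) (h1 : ρ < 1) {N : ℕ} (hN : Connects A N) :
    ∃ M : ℝ, 1 ≤ M ∧ ∃ c : ℝ, 0 < c ∧ ∃ θ : ℝ, 0 < θ ∧ θ < 1 ∧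
      ∀ (D : ℝ) (g : (ℕ → Fin a) → ℝ), 0 ≤ D → InBall ρ M D g →
        ∀ k, InBall ρ M (c * θ ^ k * D) ((branchOp r q)^[k] g) := by
  obtain ⟨M, hM, m, hm, κ, hκ0, hκ1, h⟩ := hq.exists_contraction hr h0 h1 hN
  set θ := κ ^ (1 / (m : ℝ)) with hθ
  have hθ0 : 0 < θ := Real.rpow_pos_of_pos hκ0 _
  have hθ1 : θ < 1 := Real.rpow_lt_one hκ0.le hκ1 (by positivity)
  have hθm : θ ^ m = κ := by
    rw [hθ, one_div, Real.rpow_inv_natCast_pow hκ0.le hm.ne']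
  refine ⟨M, hM, κ⁻¹, by positivity, θ, hθ0, hθ1, fun D g hD hg k => ?_⟩
  have hblock : ∀ j, InBall ρ M (κ ^ j * D) ((branchOp r q)^[m * j] g) := by
    intro j
    induction j with
    | zero => simpa using hg
    | succ j ih =>
      rw [Nat.mul_succ, Nat.add_comm (m * j), Function.iterate_add_apply, pow_succ', mul_assoc]
      exact (h _ _ (by positivity) ih).2
  have hrest : ∀ i, InBall ρ M (κ ^ (k / m) * D) ((branchOp r q)^[i + m * (k / m)] g) := by
    intro i
    induction i with
    | zero => simpa using hblock (k / m)
    | succ i ih =>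
      rw [Nat.add_right_comm, Function.iterate_succ_apply']
      exact (h _ _ (by positivity) ih).1
  have := hrest (k % m)
  rw [Nat.mod_add_div] at this
  refine this.mono h0.le (by linarith) ?_
  gcongr
  rw [← div_eq_inv_mul, le_div_iff₀ hκ0]
  calc κ ^ (k / m) * κ = θ ^ (m * (k / m) + m) := by rw [pow_add, pow_mul, hθm]
    _ ≤ θ ^ (m * (k / m) + k % m) :=
        pow_le_pow_of_le_one hθ0.le hθ1.le (by have := Nat.mod_lt k hm; omega)
    _ = θ ^ k := by rw [Nat.div_add_mod]

theorem exists_poisson_solution (hq : MarkovWeights A ρ δ q) (hr : Retraction A r)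
    (h0 : 0 < ρ) (h1 : ρ < 1) {N : ℕ} (hN : Connects A N) :
    ∃ M : ℝ, 0 < M ∧ ∀ (K : ℝ) (g : (ℕ → Fin a) → ℝ), 0 ≤ K → HolWith ρ K g →
      (∀ k, ∃ x y, (branchOp r q)^[k] g x ≤ 0 ∧ 0 ≤ (branchOp r q)^[k] g y) →
      ∃ w, HolWith ρ (M * K) w ∧ (∀ x, |w x| ≤ M * K) ∧
        ∀ x, w x - branchOp r q w x = g x := by
  obtain ⟨M, hM, c, hc, θ, hθ0, hθ1, h⟩ := hq.exists_geometric_contraction hr h0 h1 hN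
  have h1θ : 0 < 1 - θ := by linarith
  set S := c / (1 - θ) with hS
  have hS0 : 0 < S := by positivity
  refine ⟨M * S / ρ, by positivity, fun K g hK hg hc' => ?_⟩
  have hball : InBall ρ M K g := by
    refine ⟨fun x y => ?_, fun n x y hxy => (hg (n + 1) x y hxy).trans ?_⟩
    · simpa using (le_abs_self _).trans (hg 0 x y (by simp))
    · rw [pow_succ']
      have : K * ρ ≤ M * K := by nlinarith
      calc K * (ρ * ρ ^ n) = K * ρ * ρ ^ n := by ring
        _ ≤ _ := by gcongr
  have hk := h K g hK hball
  have habs : ∀ k x, |(branchOp r q)^[k] g x| ≤ c * θ ^ k * K := by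
    intro k x
    obtain ⟨y, z, hy, hz⟩ := hc' k
    have l1 := (hk k).1 x y
    have l2 := (hk k).1 z x
    exact abs_le.2 ⟨by linarith, by linarith⟩
  have hgeo : HasSum (fun k : ℕ => c * θ ^ k * K) (S * K) := by
    have := ((hasSum_geometric_of_lt_one hθ0.le hθ1).mul_left c).mul_right K
    simpa [hS, div_eq_mul_inv] using this
  have hsum : ∀ x, Summable fun k => (branchOp r q)^[k] g x := fun x =>
    Summable.of_norm_bounded hgeo.summable fun k => by simpa using habs k x
  have hMS : S ≤ M * S / ρ := by
    rw [le_div_iff₀ h0]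
    nlinarith
  refine ⟨fun x => ∑' k, (branchOp r q)^[k] g x, ?_, fun x => ?_, fun x => ?_⟩
  · intro n x y hxy
    rw [← (hsum x).tsum_sub (hsum y)]
    rcases n with _ | n
    · refine (tsum_of_norm_bounded (f := fun k => (branchOp r q)^[k] g x -
        (branchOp r q)^[k] g y) hgeo fun k => ?_).trans ?_
      · rw [Real.norm_eq_abs, abs_le]
        exact ⟨by linarith [(hk k).1 y x], (hk k).1 x y⟩
      · rw [pow_zero, mul_one]
        gcongr
    · refine (tsum_of_norm_bounded (f := fun k => (branchOp r q)^[k] g x -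
        (branchOp r q)^[k] g y) ((hgeo.mul_left M).mul_right (ρ ^ n)) fun k =>
          (hk k).2 n x y hxy).trans_eq ?_
      rw [pow_succ]
      field_simp
  · refine (tsum_of_norm_bounded (f := fun k => (branchOp r q)^[k] g x) hgeo
      fun k => habs k x).trans ?_
    gcongr
  · have e : branchOp r q (fun x => ∑' k, (branchOp r q)^[k] g x) x =
        ∑' k, (branchOp r q)^[k + 1] g x := by
      simp only [Function.iterate_succ_apply']
      simp only [branchOp]
      rw [Summable.tsum_finsetSum fun i _ => (hsum _).mul_left _]
      exact Finset.sum_congr rfl fun i _ => ((hsum _).tsum_mul_left _).symm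
    have e' := (hsum x).tsum_eq_zero_add
    simp only [e, e', Function.iterate_zero, id_eq, add_sub_cancel_right]

end MarkovWeights

end BranchOp

/-- Branch weights of the transfer operator normalized by its leading eigenvalue. -/
noncomputable def ruelleWeight {a : ℕ} (A : Fin a → Fin a → Bool) (F : (ℕ → Fin a) → ℝ)
    (lam : ℝ) (i : Fin a) (x : ℕ → Fin a) : ℝ :=
  if A i (x 0) = true then lam⁻¹ * Real.exp (F (cons i x)) else 0

/-- Branch weights of the Markov operator obtained by conjugating with the eigenfunction. -/
noncomputable def markovWeight {a : ℕ} (A : Fin a → Fin a → Bool) (F ψ : (ℕ → Fin a) → ℝ)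
    (lam : ℝ) (i : Fin a) (x : ℕ → Fin a) : ℝ :=
  ruelleWeight A F lam i x * (ψ (cons i x) * (ψ x)⁻¹)

/-- The indicator function of the cylinder `[c₀,…,c_{n-1}]` in the full shift. -/
noncomputable def cylInd {a : ℕ} (n : ℕ) (c : ℕ → Fin a) (x : ℕ → Fin a) : ℝ :=
  open Classical in if ∀ i < n, x i = c i then 1 else 0

/-- A Hölder potential together with its leading eigendata, extended to the full shift. -/
structure RuelleTriple {a : ℕ} (A : Fin a → Fin a → Bool) (r : (ℕ → Fin a) → ℕ → Fin a)
    (ρ : ℝ) (N : ℕ) (F : (ℕ → Fin a) → ℝ) (lam : ℝ) (ψ : (ℕ → Fin a) → ℝ) (c : ℝ)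
    (ν : Measure (ℕ → Fin a)) : Prop where
  ret : Retraction A r
  rho_pos : 0 < ρ
  rho_lt : ρ < 1
  connects : Connects A N
  hol : Hol ρ F
  lam_pos : 0 < lam
  psi_hol : Hol ρ ψ
  c_pos : 0 < c
  le_psi : ∀ x, c ≤ ψ x
  psi_ret : ∀ x, ψ (r x) = ψ x
  eig : ∀ x ∈ SFT A, transfer A F ψ x = lam * ψ x
  eigm : Eigenmeasure A F lam ν
  norm : ∫ x, ψ x ∂ν = 1

theorem continuous_shift {a : ℕ} : Continuous (shift : (ℕ → Fin a) → ℕ → Fin a) :=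
  continuous_pi fun n => continuous_apply (n + 1)

theorem integrable_of_continuous {a : ℕ} {ν : Measure (ℕ → Fin a)} [IsFiniteMeasure ν]
    {g : (ℕ → Fin a) → ℝ} (hg : Continuous g) : Integrable g ν :=
  hg.integrable_of_hasCompactSupport (HasCompactSupport.of_compactSpace g)

theorem ruelleWeight_eq_zero {a : ℕ} {A : Fin a → Fin a → Bool} {F : (ℕ → Fin a) → ℝ}
    {lam : ℝ} (i : Fin a) (x : ℕ → Fin a) (h : A i (x 0) ≠ true) :
    ruelleWeight A F lam i x = 0 := if_neg h

theorem branchOp_ruelleWeight {a : ℕ} {A : Fin a → Fin a → Bool}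
    {r : (ℕ → Fin a) → ℕ → Fin a} {F : (ℕ → Fin a) → ℝ} {lam : ℝ} (g : (ℕ → Fin a) → ℝ)
    (x : ℕ → Fin a) :
    branchOp r (ruelleWeight A F lam) g x = lam⁻¹ * transfer A F g (r x) := by
  simp only [branchOp, transfer, Finset.mul_sum, ruelleWeight]
  refine Finset.sum_congr rfl fun i _ => ?_
  split_ifs <;> ring

theorem Eigenmeasure.ae_mem {a : ℕ} {A : Fin a → Fin a → Bool} {F : (ℕ → Fin a) → ℝ}
    {lam : ℝ} {ν : Measure (ℕ → Fin a)} (h : Eigenmeasure A F lam ν) :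
    ∀ᵐ x ∂ν, x ∈ SFT A := mem_ae_iff.2 h.2.1

theorem hol_cylInd {a : ℕ} {ρ : ℝ} (h0 : 0 < ρ) (h1 : ρ ≤ 1) (n : ℕ) (c : ℕ → Fin a) :
    Hol ρ (cylInd n c) := by
  refine Hol.of_agree h0 h1 (B := 1) (fun x => ?_) n fun x y h => ?_
  · rw [cylInd]
    split_ifs <;> simp
  · have : (∀ i < n, x i = c i) ↔ ∀ i < n, y i = c i :=
      forall₂_congr fun i hi => by rw [h i hi]
    simp only [cylInd, this]

theorem cylInd_nonneg {a : ℕ} (n : ℕ) (c x : ℕ → Fin a) : 0 ≤ cylInd n c x := by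
  rw [cylInd]
  split_ifs <;> simp

theorem cylInd_succ {a : ℕ} (n : ℕ) (c x : ℕ → Fin a) :
    cylInd (n + 1) c x = cylInd n c x * if shift^[n] x 0 = c n then 1 else 0 := by
  have : (∀ i < n + 1, x i = c i) ↔ (∀ i < n, x i = c i) ∧ shift^[n] x 0 = c n := by
    rw [iterate_shift_apply, add_zero]
    exact Nat.forall_lt_succ_right
  simp only [cylInd, this]
  by_cases h1 : ∀ i < n, x i = c i <;> by_cases h2 : shift^[n] x 0 = c n <;> simp [h1, h2]

/-- Nonnegative functions whose logarithm is Hölder on one-cylinders. -/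
def LogHol {a : ℕ} (ρ K : ℝ) (v : (ℕ → Fin a) → ℝ) : Prop :=
  (∀ x, 0 ≤ v x) ∧ ∀ (n : ℕ) (x y : ℕ → Fin a), (∀ i < n + 1, x i = y i) →
    v x ≤ Real.exp (K * ρ ^ n) * v y

namespace LogHol

variable {a : ℕ} {A : Fin a → Fin a → Bool} {r : (ℕ → Fin a) → ℕ → Fin a}
  {F v : (ℕ → Fin a) → ℝ} {ρ K C lam : ℝ}

theorem indicator_mul (hv : LogHol ρ K v) (j : Fin a) :
    LogHol ρ K (fun x => (if x 0 = j then 1 else 0) * v x) := by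
  refine ⟨fun x => mul_nonneg (by split_ifs <;> simp) (hv.1 x), fun n x y hxy => ?_⟩
  have h := hv.2 n x y hxy
  beta_reduce
  rw [← hxy 0 (by omega)]
  split_ifs
  · simpa using h
  · simp

theorem branchOp_ruelle (hv : LogHol ρ K v) (hr : Retraction A r) (h0 : 0 ≤ ρ)
    (h1 : ρ ≤ 1) (hlam : 0 ≤ lam) (hC : 0 ≤ C) (hF : HolWith ρ C F) (hK : (K + C) * ρ ≤ K) :
    LogHol ρ K (branchOp r (ruelleWeight A F lam) v) := by
  refine ⟨fun x => branchOp_nonneg (fun i x => ?_) hv.1 x, fun n x y hxy => ?_⟩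
  · rw [ruelleWeight]
    split_ifs <;> positivity
  rw [branchOp, branchOp, Finset.mul_sum]
  refine Finset.sum_le_sum fun i _ => ?_
  have hxy' := cons_agree i (hr.agree _ _ _ hxy)
  rw [ruelleWeight, ruelleWeight, ← hr.agree _ _ _ hxy 0 (by omega)]
  split_ifs
  · have b1 := hv.2 _ _ _ hxy'
    have b2 := (le_abs_self _).trans (hF _ _ _ hxy')
    have b3 : Real.exp (F (cons i (r x))) ≤
        Real.exp (C * ρ ^ (n + 1)) * Real.exp (F (cons i (r y))) := by
      rw [← Real.exp_add]
      refine Real.exp_le_exp.2 ?_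
      have : C * ρ ^ (n + 1 + 1) ≤ C * ρ ^ (n + 1) :=
        mul_le_mul_of_nonneg_left (pow_le_pow_of_le_one h0 h1 (Nat.le_succ _)) hC
      linarith
    have b4 : Real.exp (C * ρ ^ (n + 1)) * Real.exp (K * ρ ^ (n + 1)) ≤
        Real.exp (K * ρ ^ n) := by
      rw [← Real.exp_add]
      refine Real.exp_le_exp.2 ?_
      calc _ = (K + C) * ρ * ρ ^ n := by ring
        _ ≤ _ := by gcongr
    have hvy := hv.1 (cons i (r y))
    calc lam⁻¹ * Real.exp (F (cons i (r x))) * v (cons i (r x)) ≤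
          lam⁻¹ * (Real.exp (C * ρ ^ (n + 1)) * Real.exp (F (cons i (r y)))) *
            (Real.exp (K * ρ ^ (n + 1)) * v (cons i (r y))) := by
          gcongr
          exact hv.1 _
      _ = (Real.exp (C * ρ ^ (n + 1)) * Real.exp (K * ρ ^ (n + 1))) *
            (lam⁻¹ * Real.exp (F (cons i (r y))) * v (cons i (r y))) := by ring
      _ ≤ _ := by gcongr
  · simp

theorem holWith (hv : LogHol ρ K v) (h0 : 0 < ρ) (h1 : ρ ≤ 1) (hK : 0 ≤ K) {S : ℝ}
    (hS : ∀ x, v x ≤ S) : HolWith ρ ((1 + K * Real.exp K / ρ) * S) v := by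
  have key : ∀ (n : ℕ) (x y : ℕ → Fin a), (∀ i < n, x i = y i) →
      v x - v y ≤ (1 + K * Real.exp K / ρ) * S * ρ ^ n := by
    intro n x y hxy
    have hS0 : 0 ≤ S := (hv.1 x).trans (hS x)
    rcases n with _ | n
    · rw [pow_zero, mul_one]
      have : 0 ≤ K * Real.exp K / ρ * S := by positivity
      linarith [hS x, hv.1 y]
    · have hz : K * ρ ^ n ≤ K := mul_le_of_le_one_right hK (pow_le_one₀ h0.le h1)
      have e1 : Real.exp (K * ρ ^ n) - 1 ≤ K * ρ ^ n * Real.exp K := by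
        have h2 := Real.add_one_le_exp (-(K * ρ ^ n))
        have h3 : Real.exp (K * ρ ^ n) * Real.exp (-(K * ρ ^ n)) = 1 := by
          rw [← Real.exp_add]; simp
        have h4 : Real.exp (K * ρ ^ n) ≤ Real.exp K := Real.exp_le_exp.2 hz
        have h5 : Real.exp (K * ρ ^ n) - 1 ≤ K * ρ ^ n * Real.exp (K * ρ ^ n) := by
          nlinarith [Real.exp_pos (K * ρ ^ n)]
        exact h5.trans (by gcongr)
      calc v x - v y ≤ (Real.exp (K * ρ ^ n) - 1) * v y := by linarith [hv.2 n x y hxy]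
        _ ≤ K * ρ ^ n * Real.exp K * S :=
          mul_le_mul e1 (hS y) (hv.1 y) (by positivity)
        _ = K * Real.exp K / ρ * S * ρ ^ (n + 1) := by rw [pow_succ]; field_simp
        _ ≤ _ := by gcongr; linarith
  intro n x y hxy
  exact abs_sub_le_iff.2 ⟨key n x y hxy, key n y x fun i hi => (hxy i hi).symm⟩

end LogHol

namespace RuelleTriple

variable {a : ℕ} {A : Fin a → Fin a → Bool} {r : (ℕ → Fin a) → ℕ → Fin a} {ρ : ℝ} {N : ℕ}
  {F ψ : (ℕ → Fin a) → ℝ} {lam c : ℝ} {ν : Measure (ℕ → Fin a)}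

theorem isProbabilityMeasure (h : RuelleTriple A r ρ N F lam ψ c ν) :
    IsProbabilityMeasure ν := h.eigm.1

theorem integrable (h : RuelleTriple A r ρ N F lam ψ c ν) {g : (ℕ → Fin a) → ℝ}
    (hg : Continuous g) : Integrable g ν :=
  have := h.isProbabilityMeasure
  integrable_of_continuous hg

theorem cont (h : RuelleTriple A r ρ N F lam ψ c ν) {g : (ℕ → Fin a) → ℝ}
    (hg : Hol ρ g) : Continuous g := hg.continuous h.rho_pos.le h.rho_lt

theorem psi_pos (h : RuelleTriple A r ρ N F lam ψ c ν) (x : ℕ → Fin a) : 0 < ψ x :=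
  h.c_pos.trans_le (h.le_psi x)

theorem hol_ruelleWeight (h : RuelleTriple A r ρ N F lam ψ c ν) (i : Fin a) :
    Hol ρ (ruelleWeight A F lam i) := by
  have h1 : Hol ρ (fun x : ℕ → Fin a => if A i (x 0) = true then (1 : ℝ) else 0) :=
    Hol.of_agree h.rho_pos h.rho_lt.le (B := 1) (fun x => by split_ifs <;> simp) 1
      fun x y hxy => by rw [hxy 0 one_pos]
  have h2 := h1.mul h.rho_pos.le (((h.hol.comp_cons i).exp).const_mul h.rho_pos.le lam⁻¹)
  convert h2 using 2 with x
  simp [ruelleWeight]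

theorem hol_markovWeight (h : RuelleTriple A r ρ N F lam ψ c ν) (i : Fin a) :
    Hol ρ (markovWeight A F ψ lam i) :=
  (h.hol_ruelleWeight i).mul h.rho_pos.le
    ((h.psi_hol.comp_cons i).mul h.rho_pos.le (h.psi_hol.inv h.c_pos h.le_psi))

theorem ruelleWeight_nonneg (h : RuelleTriple A r ρ N F lam ψ c ν) (i : Fin a)
    (x : ℕ → Fin a) : 0 ≤ ruelleWeight A F lam i x := by
  have := h.lam_pos
  rw [ruelleWeight]
  split_ifs <;> positivity

theorem hol_op (h : RuelleTriple A r ρ N F lam ψ c ν) {g : (ℕ → Fin a) → ℝ}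
    (hg : Hol ρ g) : Hol ρ (branchOp r (ruelleWeight A F lam) g) :=
  hg.branchOp h.ret h.rho_pos.le h.hol_ruelleWeight

theorem hol_iterate (h : RuelleTriple A r ρ N F lam ψ c ν) {g : (ℕ → Fin a) → ℝ}
    (hg : Hol ρ g) (n : ℕ) : Hol ρ ((branchOp r (ruelleWeight A F lam))^[n] g) :=
  hg.iterate_branchOp h.ret h.rho_pos.le h.hol_ruelleWeight n

theorem exists_ruelleWeight_ge (h : RuelleTriple A r ρ N F lam ψ c ν) :
    ∃ δ, 0 < δ ∧ ∀ i x, A i (x 0) = true → δ ≤ ruelleWeight A F lam i x := by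
  obtain ⟨B, hB, hFB⟩ := h.hol.bounded
  have := h.lam_pos
  refine ⟨lam⁻¹ * Real.exp (-B), by positivity, fun i x hi => ?_⟩
  rw [ruelleWeight, if_pos hi]
  gcongr
  exact (abs_le.1 (hFB _)).1

theorem op_psi (h : RuelleTriple A r ρ N F lam ψ c ν) (x : ℕ → Fin a) :
    branchOp r (ruelleWeight A F lam) ψ x = ψ x := by
  have := h.lam_pos
  rw [branchOp_ruelleWeight, h.eig _ (h.ret.mem x), h.psi_ret]
  field_simp

theorem psi_mul_branchOp (h : RuelleTriple A r ρ N F lam ψ c ν) (g : (ℕ → Fin a) → ℝ)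
    (x : ℕ → Fin a) :
    ψ x * branchOp r (markovWeight A F ψ lam) g x =
      branchOp r (ruelleWeight A F lam) (fun x => ψ x * g x) x := by
  have := (h.psi_pos x).ne'
  simp only [branchOp, markovWeight, Finset.mul_sum, h.psi_ret]
  refine Finset.sum_congr rfl fun i _ => ?_
  field_simp

theorem psi_mul_iterate (h : RuelleTriple A r ρ N F lam ψ c ν) (g : (ℕ → Fin a) → ℝ)
    (n : ℕ) (x : ℕ → Fin a) :
    ψ x * (branchOp r (markovWeight A F ψ lam))^[n] g x =
      (branchOp r (ruelleWeight A F lam))^[n] (fun x => ψ x * g x) x := by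
  induction n generalizing x with
  | zero => rfl
  | succ n ih =>
    rw [Function.iterate_succ_apply', Function.iterate_succ_apply', h.psi_mul_branchOp]
    exact congrArg (fun g => branchOp r (ruelleWeight A F lam) g x) (funext ih)

theorem exists_markovWeights (h : RuelleTriple A r ρ N F lam ψ c ν) :
    ∃ δ, MarkovWeights A ρ δ (markovWeight A F ψ lam) := by
  obtain ⟨δ, hδ, hw⟩ := h.exists_ruelleWeight_ge
  obtain ⟨B, hB, hψB⟩ := h.psi_hol.bounded
  have hc := h.c_pos
  refine ⟨δ * (c * B⁻¹), fun i x => ?_, h.hol_markovWeight, by positivity,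
    fun i x _ hi => ?_, fun x hx => ?_⟩
  · exact mul_nonneg (h.ruelleWeight_nonneg i x)
      (mul_nonneg (h.psi_pos _).le (inv_nonneg.2 (h.psi_pos _).le))
  · refine mul_le_mul (hw i x hi) (mul_le_mul (h.le_psi _) ?_ (by positivity)
      (h.psi_pos _).le) (by positivity) (h.ruelleWeight_nonneg i x)
    exact inv_anti₀ (h.psi_pos x) ((le_abs_self _).trans (hψB x))
  · have h1 := h.psi_mul_branchOp (fun _ => 1) x
    simp only [mul_one, h.op_psi] at h1
    rw [branchOp, h.ret.fixed x hx] at h1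
    simpa [(h.psi_pos x).ne'] using h1

theorem integral_op (h : RuelleTriple A r ρ N F lam ψ c ν) {g : (ℕ → Fin a) → ℝ}
    (hg : Continuous g) :
    ∫ x, branchOp r (ruelleWeight A F lam) g x ∂ν = ∫ x, g x ∂ν := by
  have h1 : ∫ x, branchOp r (ruelleWeight A F lam) g x ∂ν =
      ∫ x, lam⁻¹ * transfer A F g x ∂ν := by
    refine integral_congr_ae ?_
    filter_upwards [h.eigm.ae_mem] with x hx
    rw [branchOp_ruelleWeight, h.ret.fixed x hx]
  rw [h1, integral_const_mul, h.eigm.2.2 g hg, inv_mul_cancel_left₀ h.lam_pos.ne']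

theorem op_mul_comp_shift (g H : (ℕ → Fin a) → ℝ) (x : ℕ → Fin a) :
    branchOp r (ruelleWeight A F lam) (fun x => g x * H (shift x)) x =
      branchOp r (ruelleWeight A F lam) g x * H (r x) := by
  simp only [branchOp, Finset.sum_mul, shift_cons, mul_assoc]

theorem integral_op_mul (h : RuelleTriple A r ρ N F lam ψ c ν) {g H : (ℕ → Fin a) → ℝ}
    (hg : Continuous g) (hH : Continuous H) :
    ∫ x, branchOp r (ruelleWeight A F lam) g x * H x ∂ν = ∫ x, g x * H (shift x) ∂ν := by
  rw [← h.integral_op (g := fun x => g x * H (shift x)) (hg.mul (hH.comp continuous_shift))]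
  refine integral_congr_ae ?_
  filter_upwards [h.eigm.ae_mem] with x hx
  rw [op_mul_comp_shift, h.ret.fixed x hx]

theorem integral_iterate_mul (h : RuelleTriple A r ρ N F lam ψ c ν)
    {g H : (ℕ → Fin a) → ℝ} (hg : Hol ρ g) (hH : Continuous H) (n : ℕ) :
    ∫ x, (branchOp r (ruelleWeight A F lam))^[n] g x * H x ∂ν =
      ∫ x, g x * H (shift^[n] x) ∂ν := by
  induction n generalizing H with
  | zero => rfl
  | succ n ih =>
    simp only [Function.iterate_succ_apply']
    rw [h.integral_op_mul (h.cont (h.hol_iterate hg n)) hH,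
      ih (H := fun z => H (shift z)) (hH.comp continuous_shift)]

theorem integral_iterate (h : RuelleTriple A r ρ N F lam ψ c ν)
    {g : (ℕ → Fin a) → ℝ} (hg : Hol ρ g) (n : ℕ) :
    ∫ x, (branchOp r (ruelleWeight A F lam))^[n] g x ∂ν = ∫ x, g x ∂ν := by
  simpa using h.integral_iterate_mul hg (continuous_const (y := (1 : ℝ))) n

theorem exists_sign_change (h : RuelleTriple A r ρ N F lam ψ c ν) {u : (ℕ → Fin a) → ℝ}
    (hu : Continuous u) (hu0 : ∫ x, u x ∂ν = 0) : ∃ x y, u x ≤ 0 ∧ 0 ≤ u y := by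
  have := h.isProbabilityMeasure
  obtain ⟨x, hx⟩ := exists_le_integral (h.integrable hu)
  obtain ⟨y, hy⟩ := exists_integral_le (h.integrable hu)
  exact ⟨x, y, hx.trans_eq hu0, hu0.symm.trans_le hy⟩

theorem exists_poisson_solution (h : RuelleTriple A r ρ N F lam ψ c ν) :
    ∃ M : ℝ, 0 < M ∧ ∀ (K : ℝ) (u : (ℕ → Fin a) → ℝ), 0 ≤ K → HolWith ρ K u →
      ∫ x, u x ∂ν = 0 → ∃ w, Hol ρ w ∧ (∀ x, |w x| ≤ M * K) ∧
        ∀ x ∈ SFT A, w x - branchOp r (ruelleWeight A F lam) w x = u x := by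
  have h0 := h.rho_pos
  obtain ⟨δ, hq⟩ := h.exists_markovWeights
  obtain ⟨M, hM, hp⟩ := hq.exists_poisson_solution h.ret h0 h.rho_lt h.connects
  obtain ⟨B, hB, hψB⟩ := h.psi_hol.bounded
  have hinv := h.psi_hol.inv h.c_pos h.le_psi
  obtain ⟨B', hB', hiB⟩ := hinv.bounded
  obtain ⟨C', hC', hi⟩ := hinv
  refine ⟨B * (M * (B' + C')), by positivity, fun K u hK hu hu0 => ?_⟩
  have huH : Hol ρ u := ⟨K, hK, hu⟩
  obtain ⟨x₀, y₀, hx₀, hy₀⟩ := h.exists_sign_change (h.cont huH) hu0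
  have huK : ∀ x, |u x| ≤ K := by
    intro x
    have h1 := (le_abs_self _).trans (hu 0 x x₀ (by simp))
    have h2 := (le_abs_self _).trans (hu 0 y₀ x (by simp))
    rw [pow_zero, mul_one] at h1 h2
    exact abs_le.2 ⟨by linarith, by linarith⟩
  have hmul : (fun x => ψ x * (u x * (ψ x)⁻¹)) = u := by
    funext x
    have := (h.psi_pos x).ne'
    field_simp
  have hg := hu.mul h0.le hK hi huK hiB
  obtain ⟨w, hw, hwB, hws⟩ := hp (K * B' + K * C') (fun x => u x * (ψ x)⁻¹) (by positivity) hg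
    fun k => by
      obtain ⟨x, y, hx, hy⟩ := h.exists_sign_change (h.cont (h.hol_iterate huH k))
        ((h.integral_iterate huH k).trans hu0)
      rw [← hmul, ← h.psi_mul_iterate] at hx hy
      exact ⟨x, y, nonpos_of_mul_nonpos_right hx (h.psi_pos x),
        nonneg_of_mul_nonneg_right hy (h.psi_pos y)⟩
  refine ⟨fun x => ψ x * w x, h.psi_hol.mul h0.le ⟨_, by positivity, hw⟩, fun x => ?_,
    fun x _ => ?_⟩
  · rw [abs_mul]
    calc _ ≤ B * (M * (K * B' + K * C')) := by
          gcongr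
          exacts [hψB x, hwB x]
      _ = _ := by ring
  · rw [← h.psi_mul_branchOp, ← mul_sub, hws]
    exact congrFun hmul x

theorem exists_poisson (h : RuelleTriple A r ρ N F lam ψ c ν) {u : (ℕ → Fin a) → ℝ}
    (hu : Hol ρ u) (hu0 : ∫ x, u x ∂ν = 0) :
    ∃ w, Hol ρ w ∧ ∀ x ∈ SFT A, w x - branchOp r (ruelleWeight A F lam) w x = u x := by
  obtain ⟨M, -, hp⟩ := h.exists_poisson_solution
  obtain ⟨K, hK, hu⟩ := hu
  obtain ⟨w, hw, -, hws⟩ := hp K u hK hu hu0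
  exact ⟨w, hw, hws⟩

theorem iterate_mul_comp (h : RuelleTriple A r ρ N F lam ψ c ν) (n : ℕ)
    (u H : (ℕ → Fin a) → ℝ) {x : ℕ → Fin a} (hx : x ∈ SFT A) :
    (branchOp r (ruelleWeight A F lam))^[n] (fun x => u x * H (shift^[n] x)) x =
      (branchOp r (ruelleWeight A F lam))^[n] u x * H x := by
  induction n generalizing H x with
  | zero => rfl
  | succ n ih =>
    rw [Function.iterate_succ_apply', Function.iterate_succ_apply']
    simp only [Function.iterate_succ_apply' shift]
    rw [branchOp_congr h.ret ruelleWeight_eq_zero fun y hy => ih (fun z => H (shift z)) hy,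
      op_mul_comp_shift, h.ret.fixed x hx]

theorem logHol_iterate_cylInd (h : RuelleTriple A r ρ N F lam ψ c ν) :
    ∃ K, 0 ≤ K ∧ ∀ n b,
      LogHol ρ K ((branchOp r (ruelleWeight A F lam))^[n] (cylInd n b)) := by
  obtain ⟨C, hC, hF⟩ := h.hol
  have h1 : 0 < 1 - ρ := sub_pos.2 h.rho_lt
  have h0 := h.rho_pos
  have hK : 0 ≤ C / (1 - ρ) := by positivity
  have hKC : (C / (1 - ρ) + C) * ρ ≤ C / (1 - ρ) := by
    have : (C / (1 - ρ) + C) * ρ = C / (1 - ρ) - C * (1 - ρ) := by field_simp; ring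
    nlinarith
  refine ⟨C / (1 - ρ), hK, fun n b => ?_⟩
  induction n with
  | zero =>
    refine ⟨cylInd_nonneg 0 b, fun n x y _ => ?_⟩
    simpa [cylInd] using (by positivity : 0 ≤ C / (1 - ρ) * ρ ^ n)
  | succ n ih =>
    have e : (branchOp r (ruelleWeight A F lam))^[n + 1] (cylInd (n + 1) b) =
        branchOp r (ruelleWeight A F lam) (fun x => (if x 0 = b n then 1 else 0) *
          (branchOp r (ruelleWeight A F lam))^[n] (cylInd n b) x) := by
      rw [Function.iterate_succ_apply']
      funext x
      refine branchOp_congr h.ret ruelleWeight_eq_zero (fun y hy => ?_) x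
      rw [funext (cylInd_succ n b), mul_comm]
      exact h.iterate_mul_comp n (cylInd n b) (fun z => if z 0 = b n then 1 else 0) hy
    rw [e]
    exact (ih.indicator_mul (b n)).branchOp_ruelle h.ret h0.le h.rho_lt.le h.lam_pos.le hC hF hKC

theorem exists_le_mul_integral (h : RuelleTriple A r ρ N F lam ψ c ν) (K : ℝ) :
    ∃ S, 0 < S ∧ ∀ v, LogHol ρ K v → Hol ρ v → ∀ y, v y ≤ S * ∫ x, v x ∂ν := by
  have := h.isProbabilityMeasure
  obtain ⟨δ, hδ, hw⟩ := h.exists_ruelleWeight_ge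
  refine ⟨Real.exp K * (δ ^ N)⁻¹, by positivity, fun v hv hvH y => ?_⟩
  have key : ∀ x ∈ SFT A, δ ^ N * (Real.exp (-K) * v y) ≤
      (branchOp r (ruelleWeight A F lam))^[N] v x := by
    intro x hx
    obtain ⟨z, hz, hzx, hzy⟩ := h.connects.exists_preimage (h.ret.mem y) hx 0
    rw [zero_add] at hzx
    have h1 := pow_mul_le_iterate_branchOp h.ret h.ruelleWeight_nonneg hδ.le
      (fun i x _ => hw i x) hv.1 N hz
    rw [hzx] at h1
    refine le_trans (mul_le_mul_of_nonneg_left ?_ (by positivity)) h1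
    have h2 := hv.2 0 y z fun i hi => by
      rw [hzy i (by omega), show i = 0 by omega, h.ret.zero]
    rw [pow_zero, mul_one] at h2
    calc _ ≤ Real.exp (-K) * (Real.exp K * v z) := by gcongr
      _ = v z := by rw [← mul_assoc, ← Real.exp_add]; simp
  have hint : δ ^ N * (Real.exp (-K) * v y) ≤ ∫ x, v x ∂ν := by
    rw [← h.integral_iterate hvH N]
    calc _ = ∫ _x, δ ^ N * (Real.exp (-K) * v y) ∂ν := by simp
      _ ≤ _ := integral_mono_ae (integrable_const _)
          (h.integrable (h.cont (h.hol_iterate hvH N))) (h.eigm.ae_mem.mono key)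
  calc v y = Real.exp K * (δ ^ N)⁻¹ * (δ ^ N * (Real.exp (-K) * v y)) := by
        rw [Real.exp_neg]
        field_simp
    _ ≤ _ := by gcongr

/-- Solution of the Poisson equation for a cylinder of length `n`: up to an error controlled
by the measure of the cylinder it is the sum of the first `n` iterates of its indicator. -/
theorem exists_poisson_cylInd (h : RuelleTriple A r ρ N F lam ψ c ν) :
    ∃ B, 0 < B ∧ ∀ (n : ℕ), ∀ b ∈ SFT A, 0 < ∫ x, cylInd n b x ∂ν ∧ ∃ w, Hol ρ w ∧
      (∀ x, |w x| ≤ B * ∫ x, cylInd n b x ∂ν) ∧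
      ∀ x ∈ SFT A,
        (∑ k ∈ Finset.range n, (branchOp r (ruelleWeight A F lam))^[k] (cylInd n b) x + w x) -
          branchOp r (ruelleWeight A F lam) (fun x => ∑ k ∈ Finset.range n,
            (branchOp r (ruelleWeight A F lam))^[k] (cylInd n b) x + w x) x =
        cylInd n b x - ∫ x, cylInd n b x ∂ν := by
  have := h.isProbabilityMeasure
  have h0 := h.rho_pos
  obtain ⟨K, hK, hlog⟩ := h.logHol_iterate_cylInd
  obtain ⟨S, hS, hle⟩ := h.exists_le_mul_integral K
  obtain ⟨M, hM, hp⟩ := h.exists_poisson_solution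
  obtain ⟨δ, hδ, hw⟩ := h.exists_ruelleWeight_ge
  refine ⟨M * ((1 + K * Real.exp K / ρ) * S), by positivity, fun n b hb => ?_⟩
  have hcH := hol_cylInd h0 h.rho_lt.le n b
  set m := ∫ x, cylInd n b x ∂ν with hm
  set v := (branchOp r (ruelleWeight A F lam))^[n] (cylInd n b) with hv
  have hvH : Hol ρ v := h.hol_iterate hcH n
  have hvm : ∫ x, v x ∂ν = m := h.integral_iterate hcH n
  have hvS : ∀ y, v y ≤ S * m := fun y => hvm ▸ hle v (hlog n b) hvH y
  have hpos : 0 < m := by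
    have h1 := pow_mul_le_iterate_branchOp h.ret h.ruelleWeight_nonneg hδ.le
      (fun i x _ => hw i x) (cylInd_nonneg n b) n hb
    have h2 : cylInd n b b = 1 := by simp [cylInd]
    rw [h2, mul_one] at h1
    have h3 := (pow_pos hδ n).trans_le (h1.trans (hvS _))
    exact pos_of_mul_pos_right h3 hS.le
  have hvW := (hlog n b).holWith h0 h.rho_lt.le hK hvS
  obtain ⟨w, hwH, hwB, hws⟩ := hp ((1 + K * Real.exp K / ρ) * (S * m)) (fun x => v x - m)
    (by positivity) (fun n x y hxy => by simpa using hvW n x y hxy)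
    (by rw [integral_sub (h.integrable (h.cont hvH)) (integrable_const _), hvm]; simp)
  refine ⟨hpos, w, hwH, fun x => (hwB x).trans_eq (by ring), fun x hx => ?_⟩
  rw [branchOp_add]
  beta_reduce
  rw [branchOp_sum]
  have h1 := hws x hx
  have h2 : ∑ k ∈ Finset.range n, (branchOp r (ruelleWeight A F lam))^[k] (cylInd n b) x -
      ∑ k ∈ Finset.range n, branchOp r (ruelleWeight A F lam)
        ((branchOp r (ruelleWeight A F lam))^[k] (cylInd n b)) x = cylInd n b x - v x := by
    simp only [← Function.iterate_succ_apply' (branchOp r (ruelleWeight A F lam))]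
    rw [← Finset.sum_sub_distrib]
    exact Finset.sum_range_sub' (fun k => (branchOp r (ruelleWeight A F lam))^[k]
      (cylInd n b) x) n
  linarith

end RuelleTriple

theorem hasFDerivAt_mul_of_eq_zero {E : Type*} [NormedAddCommGroup E] [NormedSpace ℝ E]
    {u v : E → ℝ} {u' : E →L[ℝ] ℝ} {t : E} (hu : HasFDerivAt u u' t) (hu0 : u t = 0)
    {b : ℝ} (hv : Tendsto v (nhds t) (nhds b)) :
    HasFDerivAt (fun s => u s * v s) (b • u') t := by
  have h1 : (fun s => u s * (v s - b)) =o[nhds t] fun s => s - t := by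
    have hO : u =O[nhds t] fun s => s - t := by simpa [hu0] using hu.isBigO_sub
    have ho : (fun s => v s - b) =o[nhds t] fun _ => (1 : ℝ) := by
      rw [Asymptotics.isLittleO_one_iff]
      simpa using hv.sub_const b
    simpa using (hO.norm_right.mul_isLittleO ho).norm_right
  have h2 : (fun s => b * u s - b * u t - (b • u') (s - t)) =o[nhds t] fun s => s - t :=
    (hu.const_mul b).isLittleO
  refine HasFDerivAt.of_isLittleO ((h1.add h2).congr_left fun s => ?_)
  simp only [hu0]
  ring

/-- The difference of the potentials with parameters `s` and `t`. -/
noncomputable def tilt {a d : ℕ} (f : Fin d → (ℕ → Fin a) → ℝ) (t s : Fin d → ℝ)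
    (x : ℕ → Fin a) : ℝ :=
  ∑ i, (s i - t i) * f i x

/-- The first order effect of changing the parameter of the potential from `t` to `s`. -/
noncomputable def pert {a d : ℕ} (f : Fin d → (ℕ → Fin a) → ℝ) (t : Fin d → ℝ)
    (ν : (Fin d → ℝ) → Measure (ℕ → Fin a)) (h : (ℕ → Fin a) → ℝ) (s : Fin d → ℝ) : ℝ :=
  ∫ x, (1 - Real.exp (-tilt f t s x)) * h x ∂ν s

section LinearResponse

variable {a d : ℕ} {A : Fin a → Fin a → Bool} {r : (ℕ → Fin a) → ℕ → Fin a} {ρ : ℝ} {N : ℕ}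
  {ψ f₀ h g u : (ℕ → Fin a) → ℝ} {c : ℝ} {f : Fin d → (ℕ → Fin a) → ℝ} {t : Fin d → ℝ}
  {lam : (Fin d → ℝ) → ℝ} {ν : (Fin d → ℝ) → Measure (ℕ → Fin a)}

theorem transfer_Fpot_eq (s : Fin d → ℝ) (x : ℕ → Fin a) :
    transfer A (Fpot f₀ f t) h x =
      transfer A (Fpot f₀ f s) (fun y => Real.exp (-tilt f t s y) * h y) x := by
  refine Finset.sum_congr rfl fun i _ => if_congr Iff.rfl ?_ rfl
  rw [← mul_assoc, ← Real.exp_add]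
  congr 2
  simp only [Fpot, tilt, sub_mul, Finset.sum_sub_distrib]
  ring

theorem continuous_tilt (hf : ∀ i, Continuous (f i)) (s : Fin d → ℝ) :
    Continuous (tilt f t s) :=
  continuous_finsetSum _ fun i _ => continuous_const.mul (hf i)

theorem exists_tilt_le (hf : ∀ i, Hol ρ (f i)) (t : Fin d → ℝ) :
    ∃ M, 0 < M ∧ ∀ s x, |tilt f t s x| ≤ M * ‖s - t‖ := by
  choose B hB hfB using fun i => (hf i).bounded
  refine ⟨∑ i, B i + 1, by have := Finset.sum_nonneg fun i (_ : i ∈ Finset.univ) => (hB i).le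
                           positivity, fun s x => ?_⟩
  calc |tilt f t s x| ≤ ∑ i, |(s i - t i) * f i x| := Finset.abs_sum_le_sum_abs _ _
    _ ≤ ∑ i, ‖s - t‖ * B i := by
        refine Finset.sum_le_sum fun i _ => ?_
        rw [abs_mul]
        exact mul_le_mul (norm_le_pi_norm (s - t) i) (hfB i x) (abs_nonneg _) (norm_nonneg _)
    _ ≤ _ := by
        rw [← Finset.mul_sum]
        nlinarith [norm_nonneg (s - t)]

/-- Taylor expansion of `pert` with an integral remainder. -/
theorem pert_eq (hν : ∀ s, IsProbabilityMeasure (ν s)) (hf : ∀ i, Continuous (f i))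
    (hh : Continuous h) (s : Fin d → ℝ) :
    pert f t ν h s = ∑ i, (s i - t i) * ∫ x, f i x * h x ∂ν s +
      ∫ x, (1 - Real.exp (-tilt f t s x) - tilt f t s x) * h x ∂ν s := by
  have := hν s
  have ht := continuous_tilt (t := t) hf s
  have e : ∑ i, (s i - t i) * ∫ x, f i x * h x ∂ν s = ∫ x, tilt f t s x * h x ∂ν s := by
    simp only [← integral_const_mul]
    rw [← integral_finsetSum (f := fun i x => (s i - t i) * (f i x * h x)) _ fun i _ =>
      integrable_of_continuous (continuous_const.mul ((hf i).mul hh))]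
    simp only [tilt, Finset.sum_mul, mul_assoc]
  rw [e, ← integral_add (f := fun x => tilt f t s x * h x)
    (integrable_of_continuous (ht.mul hh)) (integrable_of_continuous (by fun_prop))]
  refine integral_congr_ae (.of_forall fun x => ?_)
  ring

theorem isBigO_pert_remainder (hν : ∀ s, IsProbabilityMeasure (ν s)) (hf : ∀ i, Hol ρ (f i))
    (hh : Hol ρ h) :
    (fun s => ∫ x, (1 - Real.exp (-tilt f t s x) - tilt f t s x) * h x ∂ν s)
      =O[nhds t] fun s => ‖s - t‖ ^ 2 := by
  obtain ⟨M, hM, hMt⟩ := exists_tilt_le hf t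
  obtain ⟨B, hB, hhB⟩ := hh.bounded
  refine Asymptotics.IsBigO.of_bound (M ^ 2 * B) ?_
  filter_upwards [Metric.ball_mem_nhds t (inv_pos.2 hM)] with s hs
  rw [Metric.mem_ball, dist_eq_norm] at hs
  have := hν s
  have h1 : ∀ x, ‖(1 - Real.exp (-tilt f t s x) - tilt f t s x) * h x‖ ≤
      (M * ‖s - t‖) ^ 2 * B := by
    intro x
    have h2 : M * ‖s - t‖ ≤ 1 := by
      calc _ ≤ M * M⁻¹ := by gcongr
        _ = 1 := mul_inv_cancel₀ hM.ne'
    have h3 : |-tilt f t s x| ≤ 1 := by rw [abs_neg]; exact (hMt s x).trans h2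
    have h4 := Real.abs_exp_sub_one_sub_id_le h3
    rw [norm_mul]
    refine mul_le_mul ?_ (hhB x) (norm_nonneg _) (by positivity)
    calc _ = |Real.exp (-tilt f t s x) - 1 - -tilt f t s x| := by
          rw [Real.norm_eq_abs, ← abs_neg]; congr 1; ring
      _ ≤ _ := h4
      _ = |tilt f t s x| ^ 2 := by rw [neg_sq, sq_abs]
      _ ≤ _ := by gcongr; exact hMt s x
  calc _ ≤ (M * ‖s - t‖) ^ 2 * B := by
        simpa using norm_integral_le_of_norm_le_const (μ := ν s) (.of_forall h1)
    _ = _ := by rw [norm_pow, norm_norm]; ring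

theorem exists_abs_integral_le (hν : ∀ s, IsProbabilityMeasure (ν s)) (hh : Hol ρ h) :
    ∃ B, 0 < B ∧ ∀ s, |∫ x, h x ∂ν s| ≤ B := by
  obtain ⟨B, hB, hhB⟩ := hh.bounded
  refine ⟨B, hB, fun s => ?_⟩
  have := hν s
  simpa using norm_integral_le_of_norm_le_const (μ := ν s) (f := h) (.of_forall hhB)

theorem tendsto_pert (h0 : 0 ≤ ρ) (h1 : ρ < 1) (hν : ∀ s, IsProbabilityMeasure (ν s))
    (hf : ∀ i, Hol ρ (f i)) (hh : Hol ρ h) :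
    Tendsto (pert f t ν h) (nhds t) (nhds 0) := by
  have e := funext (pert_eq (t := t) hν (fun i => (hf i).continuous h0 h1)
    (hh.continuous h0 h1))
  rw [e, show (0 : ℝ) = ∑ i : Fin d, 0 + 0 by simp]
  refine (tendsto_finsetSum _ fun i _ => ?_).add ?_
  · obtain ⟨B, hB, hle⟩ := exists_abs_integral_le hν ((hf i).mul h0 hh)
    have h2 : Tendsto (fun s : Fin d → ℝ => s i - t i) (nhds t) (nhds 0) := by
      have : Continuous fun s : Fin d → ℝ => s i - t i := by fun_prop
      simpa using this.tendsto t
    exact h2.zero_mul_isBoundedUnder_le (isBoundedUnder_of ⟨B, hle⟩)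
  · refine (isBigO_pert_remainder hν hf hh).trans_tendsto ?_
    have : Continuous fun s : Fin d → ℝ => ‖s - t‖ ^ 2 := by fun_prop
    simpa using this.tendsto t

theorem hasFDerivAt_pert (h0 : 0 ≤ ρ) (h1 : ρ < 1) (hν : ∀ s, IsProbabilityMeasure (ν s))
    (hf : ∀ i, Hol ρ (f i)) (hh : Hol ρ h)
    (hlim : ∀ g, Hol ρ g → Tendsto (fun s => ∫ x, g x ∂ν s) (nhds t) (nhds (∫ x, g x ∂ν t))) :
    HasFDerivAt (pert f t ν h)
      (∑ i, (∫ x, f i x * h x ∂ν t) •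
        ContinuousLinearMap.proj (R := ℝ) (φ := fun _ : Fin d => ℝ) i) t := by
  have e := funext (pert_eq (t := t) hν (fun i => (hf i).continuous h0 h1)
    (hh.continuous h0 h1))
  rw [e]
  have hr := (isBigO_pert_remainder (t := t) hν hf hh).hasFDerivAt (𝕜 := ℝ) one_lt_two
  have hs : ∀ i : Fin d, HasFDerivAt (fun s : Fin d → ℝ => (s i - t i) * ∫ x, f i x * h x ∂ν s)
      ((∫ x, f i x * h x ∂ν t) •
        ContinuousLinearMap.proj (R := ℝ) (φ := fun _ : Fin d => ℝ) i) t := fun i =>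
    hasFDerivAt_mul_of_eq_zero (u := fun s : Fin d → ℝ => s i - t i)
      ((hasFDerivAt_apply (𝕜 := ℝ) (F' := fun _ : Fin d => ℝ) i t).sub_const (t i))
        (sub_self _) (hlim _ ((hf i).mul h0 hh))
  have := (HasFDerivAt.fun_sum fun i (_ : i ∈ Finset.univ) => hs i).add hr
  rwa [add_zero] at this

namespace RuelleTriple

theorem one_sub_mul_integral (T : RuelleTriple A r ρ N (Fpot f₀ f t) (lam t) ψ c (ν t))
    (hν : ∀ s, Eigenmeasure A (Fpot f₀ f s) (lam s) (ν s)) (hf : ∀ i, Hol ρ (f i))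
    (hh : Hol ρ h) (hu : Continuous u)
    (hhu : ∀ x ∈ SFT A, h x - branchOp r (ruelleWeight A (Fpot f₀ f t) (lam t)) h x = u x)
    (s : Fin d → ℝ) :
    (1 - lam s / lam t) * ∫ x, h x ∂ν s + lam s / lam t * pert f t ν h s =
      ∫ x, u x ∂ν s := by
  have := (hν s).1
  have hhc := T.cont hh
  have ht := continuous_tilt (t := t) (fun i => T.cont (hf i)) s
  have hc : Continuous fun y => Real.exp (-tilt f t s y) * h y := by fun_prop
  have e1 : ∫ x, transfer A (Fpot f₀ f t) h x ∂ν s =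
      lam s * ∫ x, Real.exp (-tilt f t s x) * h x ∂ν s := by
    rw [← (hν s).2.2 _ hc]
    simp only [← transfer_Fpot_eq s]
  have e2 : pert f t ν h s = ∫ x, h x ∂ν s - ∫ x, Real.exp (-tilt f t s x) * h x ∂ν s := by
    rw [← integral_sub (integrable_of_continuous hhc) (integrable_of_continuous hc)]
    simp only [pert, sub_mul, one_mul]
  have e3 : ∫ x, transfer A (Fpot f₀ f t) h x ∂ν s =
      lam t * (∫ x, h x ∂ν s - ∫ x, u x ∂ν s) := by
    rw [← integral_sub (integrable_of_continuous hhc) (integrable_of_continuous hu),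
      ← integral_const_mul]
    refine integral_congr_ae ?_
    filter_upwards [(hν s).ae_mem] with x hx
    rw [← hhu x hx, branchOp_ruelleWeight, T.ret.fixed x hx, sub_sub_cancel,
      mul_inv_cancel_left₀ T.lam_pos.ne']
  have := T.lam_pos.ne'
  rw [e2]
  field_simp
  linear_combination e1 - e3

theorem c_le_integral (T : RuelleTriple A r ρ N (Fpot f₀ f t) (lam t) ψ c (ν t))
    (hν : ∀ s, Eigenmeasure A (Fpot f₀ f s) (lam s) (ν s)) (s : Fin d → ℝ) :
    c ≤ ∫ x, ψ x ∂ν s := by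
  have := (hν s).1
  calc c = ∫ _x, c ∂ν s := by simp
    _ ≤ _ := integral_mono (integrable_const _)
      (integrable_of_continuous (T.cont T.psi_hol)) T.le_psi

theorem one_sub_ratio (T : RuelleTriple A r ρ N (Fpot f₀ f t) (lam t) ψ c (ν t))
    (hν : ∀ s, Eigenmeasure A (Fpot f₀ f s) (lam s) (ν s)) (hf : ∀ i, Hol ρ (f i))
    (s : Fin d → ℝ) :
    (1 - lam s / lam t) * ∫ x, ψ x ∂ν s + lam s / lam t * pert f t ν ψ s = 0 := by
  rw [T.one_sub_mul_integral hν hf T.psi_hol (continuous_const (y := 0))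
    fun x _ => by rw [T.op_psi, sub_self]]
  simp

theorem tendsto_ratio (T : RuelleTriple A r ρ N (Fpot f₀ f t) (lam t) ψ c (ν t))
    (hν : ∀ s, Eigenmeasure A (Fpot f₀ f s) (lam s) (ν s)) (hf : ∀ i, Hol ρ (f i)) :
    Tendsto (fun s => lam s / lam t) (nhds t) (nhds 1) := by
  have hp : ∀ s, 0 < ∫ x, ψ x ∂ν s := fun s => T.c_pos.trans_le (T.c_le_integral hν s)
  have h1 : Tendsto (fun s => pert f t ν ψ s * (∫ x, ψ x ∂ν s)⁻¹) (nhds t) (nhds 0) := by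
    refine (tendsto_pert T.rho_pos.le T.rho_lt (fun s => (hν s).1) hf
      T.psi_hol).zero_mul_isBoundedUnder_le (isBoundedUnder_of ⟨c⁻¹, fun s => ?_⟩)
    rw [Function.comp_apply, norm_inv, Real.norm_of_nonneg (hp s).le]
    exact inv_anti₀ T.c_pos (T.c_le_integral hν s)
  have h2 := (h1.const_sub 1).inv₀ (by simp)
  rw [sub_zero, inv_one] at h2
  refine h2.congr fun s => ?_
  have h3 := T.one_sub_ratio hν hf s
  have h4 := (hp s).ne'
  refine inv_eq_of_mul_eq_one_left ?_
  field_simp at h3 ⊢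
  linear_combination -h3

theorem integral_sub_eq (T : RuelleTriple A r ρ N (Fpot f₀ f t) (lam t) ψ c (ν t))
    (hν : ∀ s, Eigenmeasure A (Fpot f₀ f s) (lam s) (ν s)) (hf : ∀ i, Hol ρ (f i))
    (hg : Hol ρ g) (hh : Hol ρ h)
    (hhg : ∀ x ∈ SFT A, h x - branchOp r (ruelleWeight A (Fpot f₀ f t) (lam t)) h x =
      g x - ∫ x, g x ∂ν t) (s : Fin d → ℝ) :
    ∫ x, g x ∂ν s = ∫ x, g x ∂ν t + (pert f t ν h s * (lam s / lam t) -
      pert f t ν ψ s * (lam s / lam t * ((∫ x, h x ∂ν s) * (∫ x, ψ x ∂ν s)⁻¹))) := by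
  have := (hν s).1
  have hgc := T.cont hg
  have e1 := T.one_sub_mul_integral hν hf hh (u := fun x => g x - ∫ x, g x ∂ν t)
    (hgc.sub continuous_const) hhg s
  rw [integral_sub (integrable_of_continuous hgc) (integrable_const _)] at e1
  simp only [integral_const, probReal_univ, one_smul] at e1
  have e2 := T.one_sub_ratio hν hf s
  have e3 := (T.c_pos.trans_le (T.c_le_integral hν s)).ne'
  have e4 : 1 - lam s / lam t =
      -(lam s / lam t * pert f t ν ψ s * (∫ x, ψ x ∂ν s)⁻¹) := by
    rw [eq_neg_iff_add_eq_zero]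
    field_simp at e2 ⊢
    linear_combination e2
  rw [e4] at e1
  linear_combination -e1

theorem tendsto_integral (T : RuelleTriple A r ρ N (Fpot f₀ f t) (lam t) ψ c (ν t))
    (hν : ∀ s, Eigenmeasure A (Fpot f₀ f s) (lam s) (ν s)) (hf : ∀ i, Hol ρ (f i))
    (hg : Hol ρ g) :
    Tendsto (fun s => ∫ x, g x ∂ν s) (nhds t) (nhds (∫ x, g x ∂ν t)) := by
  have := T.isProbabilityMeasure
  have h0 := T.rho_pos.le
  obtain ⟨h, hh, hhg⟩ := T.exists_poisson (u := fun x => g x - ∫ x, g x ∂ν t)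
    (hg.sub h0 (Hol.const ρ _)) (by
      rw [integral_sub (T.integrable (T.cont hg)) (integrable_const _)]; simp)
  obtain ⟨B, hB, hle⟩ := exists_abs_integral_le (fun s => (hν s).1) hh
  rw [funext (T.integral_sub_eq hν hf hg hh hhg)]
  have hq := T.tendsto_ratio hν hf
  have hp := fun {h} (hh : Hol ρ h) =>
    tendsto_pert (t := t) T.rho_pos.le T.rho_lt (fun s => (hν s).1) hf hh
  have h1 : Tendsto (fun s => pert f t ν h s * (lam s / lam t)) (nhds t) (nhds (0 * 1)) :=
    (hp hh).mul hq
  have h2 : Tendsto (fun s => pert f t ν ψ s * (lam s / lam t) *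
      ((∫ x, h x ∂ν s) * (∫ x, ψ x ∂ν s)⁻¹)) (nhds t) (nhds 0) := by
    have h3 := (hp T.psi_hol).mul hq
    rw [zero_mul] at h3
    refine h3.zero_mul_isBoundedUnder_le (isBoundedUnder_of ⟨B * c⁻¹, fun s => ?_⟩)
    have h4 := T.c_le_integral hν s
    rw [Function.comp_apply, norm_mul, norm_inv,
      Real.norm_of_nonneg (T.c_pos.trans_le h4).le]
    exact mul_le_mul (hle s) (inv_anti₀ T.c_pos h4)
      (inv_nonneg.2 (T.c_pos.trans_le h4).le) hB.le
  simpa [mul_assoc] using (h1.sub h2).const_add (∫ x, g x ∂ν t)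

/-- Linear response: the derivative of `s ↦ ∫ g dν_s` is expressed through a solution of the
Poisson equation for `g`. -/
theorem hasFDerivAt_integral (T : RuelleTriple A r ρ N (Fpot f₀ f t) (lam t) ψ c (ν t))
    (hν : ∀ s, Eigenmeasure A (Fpot f₀ f s) (lam s) (ν s)) (hf : ∀ i, Hol ρ (f i))
    (hg : Hol ρ g) (hh : Hol ρ h)
    (hhg : ∀ x ∈ SFT A, h x - branchOp r (ruelleWeight A (Fpot f₀ f t) (lam t)) h x =
      g x - ∫ x, g x ∂ν t) :
    HasFDerivAt (fun s => ∫ x, g x ∂ν s)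
      (∑ i, (∫ x, (f i x - ∫ z, f i z * ψ z ∂ν t) * h x ∂ν t) •
        ContinuousLinearMap.proj (R := ℝ) (φ := fun _ : Fin d => ℝ) i) t := by
  have := T.isProbabilityMeasure
  have h0 := T.rho_pos.le
  have hlim : ∀ g, Hol ρ g → Tendsto (fun s => ∫ x, g x ∂ν s) (nhds t)
    (nhds (∫ x, g x ∂ν t)) := fun g hg => T.tendsto_integral hν hf hg
  have hq := T.tendsto_ratio hν hf
  have hd := fun {h} (hh : Hol ρ h) =>
    hasFDerivAt_pert h0 T.rho_lt (fun s => (hν s).1) hf hh hlim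
  have hpt : ∀ h, pert f t ν h t = 0 := fun h => by simp [pert, tilt]
  have hψ := (hlim ψ T.psi_hol).inv₀ (by rw [T.norm]; exact one_ne_zero)
  have e := ((hasFDerivAt_mul_of_eq_zero (hd hh) (hpt h) hq).sub
    (hasFDerivAt_mul_of_eq_zero (hd T.psi_hol) (hpt ψ)
      (hq.mul ((hlim h hh).mul hψ)))).const_add (∫ x, g x ∂ν t)
  rw [funext (T.integral_sub_eq hν hf hg hh hhg)]
  refine e.congr_fderiv ?_
  rw [T.norm, inv_one, mul_one, one_mul, one_smul, Finset.smul_sum, ← Finset.sum_sub_distrib]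
  refine Finset.sum_congr rfl fun i _ => ?_
  rw [smul_smul, ← sub_smul]
  congr 1
  simp only [sub_mul]
  rw [integral_sub (f := fun x => f i x * h x)
    (g := fun x => (∫ z, f i z * ψ z ∂ν t) * h x)
    (T.integrable ((T.cont (hf i)).mul (T.cont hh)))
    (T.integrable (continuous_const.mul (T.cont hh))), integral_const_mul]
  ring

end RuelleTriple

end LinearResponse

theorem tendsto_div_of_abs_sub_le {u : ℕ → ℝ} {c C : ℝ}
    (h : ∀ m : ℕ, |u m - m * c| ≤ C * (√m + 1)) :
    Tendsto (fun m : ℕ => (1 / (m : ℝ)) * u m) atTop (nhds c) := by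
  have h1 : Tendsto (fun m : ℕ => (√(m : ℝ))⁻¹) atTop (nhds 0) :=
    (tendsto_inv_atTop_zero.comp Real.tendsto_sqrt_atTop).comp tendsto_natCast_atTop_atTop
  have h2 : Tendsto (fun m : ℕ => C * ((√(m : ℝ))⁻¹ + (m : ℝ)⁻¹)) atTop (nhds 0) := by
    simpa using (h1.add tendsto_inv_atTop_nhds_zero_nat).const_mul C
  rw [tendsto_iff_norm_sub_tendsto_zero]
  refine squeeze_zero' (.of_forall fun m => norm_nonneg _) ?_ h2
  filter_upwards [eventually_gt_atTop 0] with m hm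
  have hm' : (0 : ℝ) < m := Nat.cast_pos.2 hm
  have e : 1 / (m : ℝ) * u m - c = (m : ℝ)⁻¹ * (u m - m * c) := by field_simp
  rw [e, norm_mul, Real.norm_of_nonneg (by positivity)]
  calc (m : ℝ)⁻¹ * ‖u m - m * c‖ ≤ (m : ℝ)⁻¹ * (C * (√m + 1)) := by gcongr; exact h m
    _ = C * ((m : ℝ)⁻¹ * √m + (m : ℝ)⁻¹) := by ring
    _ = C * ((√m)⁻¹ + (m : ℝ)⁻¹) := by
        congr 2
        have := (Real.sqrt_pos.2 hm').ne'
        field_simp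
        exact Real.sq_sqrt hm'.le

section Birkhoff

variable {a : ℕ} {f g : (ℕ → Fin a) → ℝ}

theorem birkhoff_succ (m : ℕ) (x : ℕ → Fin a) :
    birkhoff (m + 1) f x = birkhoff m f x + f (shift^[m] x) :=
  Finset.sum_range_succ _ m

theorem birkhoff_succ' (m : ℕ) (x : ℕ → Fin a) :
    birkhoff (m + 1) f x = f x + birkhoff m f (shift x) := by
  rw [birkhoff, Finset.sum_range_succ', add_comm]
  rfl

theorem birkhoff_shift (m : ℕ) (x : ℕ → Fin a) :
    birkhoff m f (shift x) = birkhoff m f x + (f (shift^[m] x) - f x) := by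
  linear_combination birkhoff_succ m x - birkhoff_succ' (f := f) m x

theorem continuous_birkhoff (hf : Continuous f) (m : ℕ) : Continuous (birkhoff m f) :=
  continuous_finsetSum _ fun k _ => hf.comp (continuous_shift.iterate k)

theorem abs_birkhoff_le {B : ℝ} (hf : ∀ x, |f x| ≤ B) (m : ℕ) (x : ℕ → Fin a) :
    |birkhoff m f x| ≤ m * B := by
  refine (Finset.abs_sum_le_sum_abs _ _).trans ?_
  simpa using Finset.sum_le_sum fun k (_ : k ∈ Finset.range m) => hf (shift^[k] x)

theorem abs_integral_mul_le {ν : Measure (ℕ → Fin a)} [IsFiniteMeasure ν] {B : ℝ}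
    (hg : ∀ x, |g x| ≤ B) (hf : Continuous f) :
    |∫ x, g x * f x ∂ν| ≤ B * ∫ x, |f x| ∂ν := by
  rw [← integral_const_mul]
  refine norm_integral_le_of_norm_le (f := fun x => g x * f x)
    (integrable_of_continuous (continuous_const.mul hf.abs)) (.of_forall fun x => ?_)
  rw [norm_mul]
  exact mul_le_mul_of_nonneg_right (hg x) (norm_nonneg _)

theorem sq_integral_abs_le {ν : Measure (ℕ → Fin a)} [IsProbabilityMeasure ν]
    (hf : Continuous f) : (∫ x, |f x| ∂ν) ^ 2 ≤ ∫ x, f x * f x ∂ν := by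
  set E := ∫ x, |f x| ∂ν with hE
  have h1 : 0 ≤ ∫ x, (|f x| - E) ^ 2 ∂ν := integral_nonneg fun x => sq_nonneg _
  have h2 : ∫ x, (|f x| - E) ^ 2 ∂ν = ∫ x, (f x * f x - 2 * E * |f x| + E ^ 2) ∂ν := by
    refine integral_congr_ae (.of_forall fun x => ?_)
    simp only
    rw [sub_sq, sq_abs]
    ring
  rw [h2, integral_add (integrable_of_continuous (by fun_prop)) (integrable_const _),
    integral_sub (integrable_of_continuous (by fun_prop))
      (integrable_of_continuous (by fun_prop)), integral_const_mul, ← hE] at h1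
  simp only [integral_const, probReal_univ, one_smul] at h1
  linarith

end Birkhoff

namespace RuelleTriple

variable {a : ℕ} {A : Fin a → Fin a → Bool} {r : (ℕ → Fin a) → ℕ → Fin a} {ρ : ℝ} {N : ℕ}
  {F ψ f g u w H : (ℕ → Fin a) → ℝ} {lam c : ℝ} {ν : Measure (ℕ → Fin a)}

theorem integral_mul_of_poisson (h : RuelleTriple A r ρ N F lam ψ c ν) (hw : Hol ρ w)
    (hwu : ∀ x ∈ SFT A, w x - branchOp r (ruelleWeight A F lam) w x = u x)
    (hH : Continuous H) :
    ∫ x, u x * H x ∂ν = ∫ x, w x * (H x - H (shift x)) ∂ν := by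
  have hwc := h.cont hw
  have e : ∫ x, u x * H x ∂ν =
      ∫ x, (w x * H x - branchOp r (ruelleWeight A F lam) w x * H x) ∂ν := by
    refine integral_congr_ae ?_
    filter_upwards [h.eigm.ae_mem] with x hx
    rw [← hwu x hx, sub_mul]
  simp only [e, mul_sub]
  rw [integral_sub (f := fun x => w x * H x)
      (g := fun x => branchOp r (ruelleWeight A F lam) w x * H x) (h.integrable (hwc.mul hH))
      (h.integrable ((h.cont (h.hol_op hw)).mul hH)), h.integral_op_mul hwc hH,
    ← integral_sub (f := fun x => w x * H x) (g := fun x => w x * H (shift x))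
      (h.integrable (hwc.mul hH)) (h.integrable (hwc.mul (hH.comp continuous_shift)))]

theorem integral_psi_mul_shift (h : RuelleTriple A r ρ N F lam ψ c ν) (hH : Continuous H) :
    ∫ x, ψ x * H (shift x) ∂ν = ∫ x, ψ x * H x ∂ν := by
  rw [← h.integral_op_mul (h.cont h.psi_hol) hH]
  simp only [h.op_psi]

/-- A centred observable, multiplied by the invariant density, is a coboundary in the sense
of correlations with the future. -/
theorem exists_corrector (h : RuelleTriple A r ρ N F lam ψ c ν) (hf : Hol ρ f)
    (hf0 : ∫ x, f x * ψ x ∂ν = 0) :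
    ∃ w, Hol ρ w ∧ ∀ H, Continuous H →
      ∫ x, ψ x * f x * H (shift x) ∂ν = ∫ x, w x * (H x - H (shift x)) ∂ν := by
  have hψf : Hol ρ fun x => ψ x * f x := h.psi_hol.mul h.rho_pos.le hf
  obtain ⟨w, hw, hwu⟩ := h.exists_poisson (h.hol_op hψf) (by
    rw [h.integral_op (h.cont hψf)]
    simpa only [mul_comm] using hf0)
  refine ⟨w, hw, fun H hH => ?_⟩
  rw [← h.integral_mul_of_poisson hw hwu hH, h.integral_op_mul (h.cont hψf) hH]

theorem integral_psi_birkhoff_mul (h : RuelleTriple A r ρ N F lam ψ c ν) (hf : Hol ρ f)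
    (hg : Hol ρ g) (hf0 : ∫ x, f x * ψ x ∂ν = 0) (hg0 : ∫ x, g x * ψ x ∂ν = 0) :
    ∃ (v : ℝ) (w w' : (ℕ → Fin a) → ℝ), Hol ρ w ∧ Hol ρ w' ∧ ∀ m : ℕ,
      ∫ x, ψ x * (birkhoff m f x * birkhoff m g x) ∂ν =
        m * v - ∫ x, w x * birkhoff m g x ∂ν - ∫ x, w' x * birkhoff m f x ∂ν := by
  obtain ⟨w, hw, hwH⟩ := h.exists_corrector hf hf0
  obtain ⟨w', hw', hwH'⟩ := h.exists_corrector hg hg0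
  have hfc := h.cont hf
  have hgc := h.cont hg
  have hψ := h.cont h.psi_hol
  have hwc := h.cont hw
  have hwc' := h.cont hw'
  refine ⟨∫ x, ψ x * (f x * g x) ∂ν + ∫ x, w x * g x ∂ν + ∫ x, w' x * f x ∂ν, w, w', hw, hw',
    fun m => ?_⟩
  induction m with
  | zero => simp [birkhoff]
  | succ m ih =>
    have hF := continuous_birkhoff hfc m
    have hG := continuous_birkhoff hgc m
    have hσ := continuous_shift (a := a)
    have hσm := hσ.iterate m
    have e1 : ∀ x, ψ x * (birkhoff (m + 1) f x * birkhoff (m + 1) g x) =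
        ψ x * (f x * g x) + ψ x * f x * birkhoff m g (shift x) +
          ψ x * g x * birkhoff m f (shift x) +
          ψ x * (birkhoff m f (shift x) * birkhoff m g (shift x)) := fun x => by
      rw [birkhoff_succ', birkhoff_succ']
      ring
    simp only [e1]
    rw [integral_add (h.integrable (by fun_prop)) (h.integrable (by fun_prop)),
      integral_add (h.integrable (by fun_prop)) (h.integrable (by fun_prop)),
      integral_add (h.integrable (by fun_prop)) (h.integrable (by fun_prop)),
      hwH _ hG, hwH' _ hF,
      h.integral_psi_mul_shift (H := fun x => birkhoff m f x * birkhoff m g x) (hF.mul hG), ih]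
    have e2 : ∀ (w f : (ℕ → Fin a) → ℝ), Continuous w → Continuous f →
        ∫ x, w x * (birkhoff m f x - birkhoff m f (shift x)) ∂ν +
          ∫ x, w x * birkhoff (m + 1) f x ∂ν =
        ∫ x, w x * birkhoff m f x ∂ν + ∫ x, w x * f x ∂ν := fun w f hw hf => by
      have hF := continuous_birkhoff hf m
      have hF' := continuous_birkhoff hf (m + 1)
      rw [← integral_add (h.integrable (by fun_prop)) (h.integrable (by fun_prop)),
        ← integral_add (h.integrable (by fun_prop)) (h.integrable (by fun_prop))]
      refine integral_congr_ae (.of_forall fun x => ?_)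
      simp only [birkhoff_succ, birkhoff_shift]
      ring
    push_cast
    linear_combination e2 w g hwc hgc + e2 w' f hwc' hfc

theorem exists_integral_abs_birkhoff_le (h : RuelleTriple A r ρ N F lam ψ c ν) (hf : Hol ρ f)
    (hf0 : ∫ x, f x * ψ x ∂ν = 0) :
    ∃ C, 0 ≤ C ∧ ∀ m : ℕ, ∫ x, |birkhoff m f x| ∂ν ≤ C * √m := by
  have := h.isProbabilityMeasure
  have hfc := h.cont hf
  have hψ := h.cont h.psi_hol
  obtain ⟨v, w, w', hw, hw', hm⟩ := h.integral_psi_birkhoff_mul hf hf hf0 hf0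
  obtain ⟨B, hB, hfB⟩ := hf.bounded
  obtain ⟨D, hD, hwD⟩ := hw.bounded
  obtain ⟨D', hD', hwD'⟩ := hw'.bounded
  have hc := h.c_pos
  set C := c⁻¹ * (|v| + D * B + D' * B) with hC
  have hC0 : 0 ≤ C := by positivity
  refine ⟨√C, Real.sqrt_nonneg _, fun m => ?_⟩
  have hF := continuous_birkhoff hfc m
  rw [← Real.sqrt_mul hC0]
  refine Real.le_sqrt_of_sq_le ((sq_integral_abs_le hF).trans ?_)
  have hb : ∫ x, |birkhoff m f x| ∂ν ≤ m * B := by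
    calc _ ≤ ∫ _x, m * B ∂ν := integral_mono (h.integrable hF.abs) (integrable_const _)
          (abs_birkhoff_le hfB m)
      _ = m * B := by simp
  have h1 := (abs_integral_mul_le hwD hF (ν := ν)).trans (mul_le_mul_of_nonneg_left hb hD.le)
  have h2 := (abs_integral_mul_le hwD' hF (ν := ν)).trans (mul_le_mul_of_nonneg_left hb hD'.le)
  have h3 : c * ∫ x, birkhoff m f x * birkhoff m f x ∂ν ≤
      ∫ x, ψ x * (birkhoff m f x * birkhoff m f x) ∂ν := by
    rw [← integral_const_mul]
    refine integral_mono (h.integrable (by fun_prop)) (h.integrable (by fun_prop)) fun x => ?_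
    exact mul_le_mul_of_nonneg_right (h.le_psi x) (mul_self_nonneg _)
  have h4 : (m : ℝ) * v ≤ m * |v| := by gcongr; exact le_abs_self v
  have h5 : c * ∫ x, birkhoff m f x * birkhoff m f x ∂ν ≤
      m * (|v| + D * B + D' * B) := by
    have := (abs_le.1 h1).1
    have := (abs_le.1 h2).1
    rw [hm] at h3
    linarith
  calc _ = c⁻¹ * (c * ∫ x, birkhoff m f x * birkhoff m f x ∂ν) := by field_simp
    _ ≤ c⁻¹ * (m * (|v| + D * B + D' * B)) := by gcongr
    _ = _ := by rw [hC]; ring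

theorem exists_abs_integral_mul_birkhoff_le (h : RuelleTriple A r ρ N F lam ψ c ν)
    (hf : Hol ρ f) (hf0 : ∫ x, f x * ψ x ∂ν = 0) (B : ℝ) (hB : 0 ≤ B) :
    ∃ C, 0 ≤ C ∧ ∀ (m : ℕ) (w : (ℕ → Fin a) → ℝ), (∀ x, |w x| ≤ B) →
      |∫ x, w x * birkhoff m f x ∂ν| ≤ C * √m := by
  have := h.isProbabilityMeasure
  obtain ⟨C, hC, hm⟩ := h.exists_integral_abs_birkhoff_le hf hf0
  refine ⟨B * C, by positivity, fun m w hw => ?_⟩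
  refine (abs_integral_mul_le hw (continuous_birkhoff (h.cont hf) m)).trans ?_
  rw [mul_assoc]
  exact mul_le_mul_of_nonneg_left (hm m) hB

/-- Asymptotics of the covariance of Birkhoff sums with respect to the eigenmeasure. -/
theorem exists_covariance (h : RuelleTriple A r ρ N F lam ψ c ν) (hf : Hol ρ f)
    (hg : Hol ρ g) (hf0 : ∫ x, f x * ψ x ∂ν = 0) (hg0 : ∫ x, g x * ψ x ∂ν = 0) :
    ∃ v C : ℝ, ∀ m : ℕ,
      |∫ x, birkhoff m f x * birkhoff m g x ∂ν - m * v| ≤ C * (√m + 1) := by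
  have := h.isProbabilityMeasure
  have hfc := h.cont hf
  have hgc := h.cont hg
  have hψ := h.cont h.psi_hol
  obtain ⟨v, w₁, w₂, hw₁, hw₂, hv⟩ := h.integral_psi_birkhoff_mul hf hg hf0 hg0
  obtain ⟨w, hw, hwu⟩ := h.exists_poisson (u := fun x => 1 - ψ x)
    ((Hol.const ρ 1).sub h.rho_pos.le h.psi_hol)
    (by rw [integral_sub (integrable_const _) (h.integrable hψ), h.norm]; simp)
  have hwc := h.cont hw
  obtain ⟨Bf, hBf, hfB⟩ := hf.bounded
  obtain ⟨Bg, hBg, hgB⟩ := hg.bounded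
  obtain ⟨B₁, hB₁, hwB₁⟩ := hw₁.bounded
  obtain ⟨B₂, hB₂, hwB₂⟩ := hw₂.bounded
  obtain ⟨B, hB, hwB⟩ := hw.bounded
  obtain ⟨C₁, hC₁, h₁⟩ := h.exists_abs_integral_mul_birkhoff_le hg hg0 B₁ hB₁.le
  obtain ⟨C₂, hC₂, h₂⟩ := h.exists_abs_integral_mul_birkhoff_le hf hf0 B₂ hB₂.le
  obtain ⟨C₃, hC₃, h₃⟩ := h.exists_abs_integral_mul_birkhoff_le hf hf0 (B * (2 * Bg))
    (by positivity)
  obtain ⟨C₄, hC₄, h₄⟩ := h.exists_abs_integral_mul_birkhoff_le hg hg0 (B * (2 * Bf))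
    (by positivity)
  refine ⟨v, C₁ + C₂ + C₃ + C₄ + B * (2 * Bf) * (2 * Bg), fun m => ?_⟩
  have hF := continuous_birkhoff hfc m
  have hG := continuous_birkhoff hgc m
  have hσ := continuous_shift (a := a)
  have hσm := hσ.iterate m
  have hd : ∀ {f : (ℕ → Fin a) → ℝ} {B : ℝ}, (∀ x, |f x| ≤ B) →
      ∀ x, |f (shift^[m] x) - f x| ≤ 2 * B := fun hf x =>
    (abs_sub _ _).trans (by linarith [hf x, hf (shift^[m] x)])
  have e1 : ∫ x, birkhoff m f x * birkhoff m g x ∂ν =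
      ∫ x, ψ x * (birkhoff m f x * birkhoff m g x) ∂ν +
        ∫ x, (1 - ψ x) * (birkhoff m f x * birkhoff m g x) ∂ν := by
    rw [← integral_add (h.integrable (by fun_prop)) (h.integrable (by fun_prop))]
    refine integral_congr_ae (.of_forall fun x => ?_)
    ring
  have e2 : ∫ x, (1 - ψ x) * (birkhoff m f x * birkhoff m g x) ∂ν =
      -(∫ x, w x * (g (shift^[m] x) - g x) * birkhoff m f x ∂ν +
        ∫ x, w x * (f (shift^[m] x) - f x) * birkhoff m g x ∂ν +
        ∫ x, w x * (f (shift^[m] x) - f x) * (g (shift^[m] x) - g x) ∂ν) := by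
    rw [h.integral_mul_of_poisson hw hwu
      (H := fun x => birkhoff m f x * birkhoff m g x) (hF.mul hG),
      ← integral_add (h.integrable (by fun_prop)) (h.integrable (by fun_prop)),
      ← integral_add (h.integrable (by fun_prop)) (h.integrable (by fun_prop)),
      ← integral_neg]
    refine integral_congr_ae (.of_forall fun x => ?_)
    simp only [birkhoff_shift]
    ring
  have b1 := h₁ m w₁ hwB₁
  have b2 := h₂ m w₂ hwB₂
  have b3 := h₃ m (fun x => w x * (g (shift^[m] x) - g x)) fun x => by
    rw [abs_mul]
    exact mul_le_mul (hwB x) (hd hgB x) (abs_nonneg _) hB.le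
  have b4 := h₄ m (fun x => w x * (f (shift^[m] x) - f x)) fun x => by
    rw [abs_mul]
    exact mul_le_mul (hwB x) (hd hfB x) (abs_nonneg _) hB.le
  have b5 : |∫ x, w x * (f (shift^[m] x) - f x) * (g (shift^[m] x) - g x) ∂ν| ≤
      B * (2 * Bf) * (2 * Bg) := by
    simpa using norm_integral_le_of_norm_le_const (μ := ν)
      (f := fun x => w x * (f (shift^[m] x) - f x) * (g (shift^[m] x) - g x))
      (C := B * (2 * Bf) * (2 * Bg)) (.of_forall fun x => by
        rw [norm_mul, norm_mul]
        exact mul_le_mul (mul_le_mul (hwB x) (hd hfB x) (abs_nonneg _) hB.le) (hd hgB x)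
          (abs_nonneg _) (by positivity))
  have hs := Real.sqrt_nonneg (m : ℝ)
  rw [e1, e2, hv]
  rw [abs_le] at *
  have p1 : 0 ≤ B * (2 * Bf) * (2 * Bg) * √m := by positivity
  constructor <;> nlinarith

end RuelleTriple

theorem exists_birkhoff_sub_le {a : ℕ} {ρ : ℝ} {g : (ℕ → Fin a) → ℝ} (h0 : 0 ≤ ρ)
    (h1 : ρ < 1) (hg : Hol ρ g) :
    ∃ D, 0 ≤ D ∧ ∀ (n : ℕ) (x y : ℕ → Fin a), (∀ i < n, x i = y i) →
      |birkhoff n g x - birkhoff n g y| ≤ D := by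
  obtain ⟨C, hC, hg⟩ := hg
  have h2 : 0 < 1 - ρ := sub_pos.2 h1
  refine ⟨C * (1 - ρ)⁻¹, by positivity, fun n x y hxy => ?_⟩
  rw [birkhoff, birkhoff, ← Finset.sum_sub_distrib]
  calc _ ≤ ∑ k ∈ Finset.range n, |g (shift^[k] x) - g (shift^[k] y)| :=
        Finset.abs_sum_le_sum_abs _ _
    _ ≤ ∑ k ∈ Finset.range n, C * ρ ^ (n - 1 - k) := by
        refine Finset.sum_le_sum fun k _ => (hg _ _ _ (iterate_shift_agree hxy)).trans ?_
        exact mul_le_mul_of_nonneg_left (pow_le_pow_of_le_one h0 h1.le (by omega)) hC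
    _ = C * ∑ k ∈ Finset.range n, ρ ^ k := by
        rw [Finset.sum_range_reflect (fun k => C * ρ ^ k), Finset.mul_sum]
    _ ≤ _ := by
        gcongr
        exact sum_le_hasSum _ (fun k _ => pow_nonneg h0 k) (hasSum_geometric_of_lt_one h0 h1)

namespace RuelleTriple

section Comparison

variable {a : ℕ} {A : Fin a → Fin a → Bool} {r : (ℕ → Fin a) → ℕ → Fin a} {ρ : ℝ} {N : ℕ}
  {F ψ f g : (ℕ → Fin a) → ℝ} {lam c : ℝ} {ν : Measure (ℕ → Fin a)}

theorem integral_mul_sum_iterate (h : RuelleTriple A r ρ N F lam ψ c ν) (hf : Hol ρ f)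
    (hg : Hol ρ g) (n : ℕ) :
    ∫ x, f x * ∑ k ∈ Finset.range n, (branchOp r (ruelleWeight A F lam))^[k] g x ∂ν =
      ∫ x, g x * birkhoff n f x ∂ν := by
  have hfc := h.cont hf
  have hgc := h.cont hg
  have hkc := fun k => h.cont (h.hol_iterate hg k)
  have hσ := continuous_shift (a := a)
  simp only [birkhoff, Finset.mul_sum]
  rw [integral_finsetSum (f := fun k x => f x * (branchOp r (ruelleWeight A F lam))^[k] g x) _
      fun k _ => h.integrable (hfc.mul (hkc k)),
    integral_finsetSum (f := fun k x => g x * f (shift^[k] x)) _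
      fun k _ => h.integrable (hgc.mul (hfc.comp (hσ.iterate k)))]
  refine Finset.sum_congr rfl fun k _ => ?_
  rw [← h.integral_iterate_mul hg hfc k]
  simp only [mul_comm]

theorem abs_integral_cylInd_mul_sub_le (h : RuelleTriple A r ρ N F lam ψ c ν)
    (hf : Hol ρ f) {D : ℝ} {n : ℕ} {b : ℕ → Fin a}
    (hD : ∀ x, (∀ i < n, x i = b i) → |birkhoff n f x - birkhoff n f b| ≤ D) :
    |∫ x, cylInd n b x * birkhoff n f x ∂ν - (∫ x, cylInd n b x ∂ν) * birkhoff n f b| ≤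
      D * ∫ x, cylInd n b x ∂ν := by
  have hc := h.cont (hol_cylInd h.rho_pos h.rho_lt.le n b)
  have hF := continuous_birkhoff (h.cont hf) n
  rw [← integral_mul_const, ← integral_const_mul,
    ← integral_sub (f := fun x => cylInd n b x * birkhoff n f x)
      (g := fun x => cylInd n b x * birkhoff n f b) (h.integrable (hc.mul hF))
      (h.integrable (hc.mul continuous_const))]
  refine norm_integral_le_of_norm_le
    (f := fun x => cylInd n b x * birkhoff n f x - cylInd n b x * birkhoff n f b)
    (h.integrable (continuous_const.mul hc)) (.of_forall fun x => ?_)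
  rw [← mul_sub, Real.norm_eq_abs, abs_mul, abs_of_nonneg (cylInd_nonneg n b x), mul_comm]
  by_cases hx : ∀ i < n, x i = b i
  · exact mul_le_mul_of_nonneg_right (hD x hx) (cylInd_nonneg n b x)
  · simp [cylInd, hx]

/-- Replacing Birkhoff sums by functions at bounded distance changes the covariance by
`O(√n)`. -/
theorem exists_integral_mul_sub_le (h : RuelleTriple A r ρ N F lam ψ c ν) (hf : Hol ρ f)
    (hg : Hol ρ g) (hf0 : ∫ x, f x * ψ x ∂ν = 0) (hg0 : ∫ x, g x * ψ x ∂ν = 0)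
    {U V : ℕ → (ℕ → Fin a) → ℝ} (hU : ∀ n, Continuous (U n)) (hV : ∀ n, Continuous (V n))
    {D D' : ℝ} (hD : 0 ≤ D) (hUf : ∀ n, ∀ x ∈ SFT A, |U n x - birkhoff n f x| ≤ D)
    (hVg : ∀ n, ∀ x ∈ SFT A, |V n x - birkhoff n g x| ≤ D') :
    ∃ C, ∀ n : ℕ,
      |∫ x, U n x * V n x ∂ν - ∫ x, birkhoff n f x * birkhoff n g x ∂ν| ≤ C * (√n + 1) := by
  have := h.isProbabilityMeasure
  obtain ⟨C₁, hC₁, h₁⟩ := h.exists_integral_abs_birkhoff_le hf hf0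
  obtain ⟨C₂, hC₂, h₂⟩ := h.exists_integral_abs_birkhoff_le hg hg0
  have hD' : 0 ≤ D' := by
    have := h.eigm.ae_mem.exists
    obtain ⟨x, hx⟩ := this
    exact (abs_nonneg _).trans (hVg 0 x hx)
  refine ⟨D' * C₁ + D * C₂ + D * D', fun n => ?_⟩
  have hF := continuous_birkhoff (h.cont hf) n
  have hG := continuous_birkhoff (h.cont hg) n
  have hUn := hU n
  have hVn := hV n
  rw [← integral_sub (f := fun x => U n x * V n x) (g := fun x => birkhoff n f x * birkhoff n g x)
      (h.integrable (hUn.mul hVn)) (h.integrable (hF.mul hG))]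
  calc _ ≤ ∫ x, (D' * |birkhoff n f x| + D * |birkhoff n g x| + D * D') ∂ν := by
        refine norm_integral_le_of_norm_le
          (f := fun x => U n x * V n x - birkhoff n f x * birkhoff n g x)
          (h.integrable (by fun_prop)) ?_
        filter_upwards [h.eigm.ae_mem] with x hx
        have e : U n x * V n x - birkhoff n f x * birkhoff n g x =
            (V n x - birkhoff n g x) * birkhoff n f x +
              (U n x - birkhoff n f x) * birkhoff n g x +
              (U n x - birkhoff n f x) * (V n x - birkhoff n g x) := by ring
        rw [e]
        refine (norm_add₃_le).trans ?_
        simp only [norm_mul, Real.norm_eq_abs]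
        have hu := hUf n x hx
        have hv := hVg n x hx
        gcongr
    _ = D' * ∫ x, |birkhoff n f x| ∂ν + D * ∫ x, |birkhoff n g x| ∂ν + D * D' := by
        rw [integral_add (h.integrable (by fun_prop)) (integrable_const _),
          integral_add (h.integrable (by fun_prop)) (h.integrable (by fun_prop)),
          integral_const_mul, integral_const_mul]
        simp
    _ ≤ D' * (C₁ * √n) + D * (C₂ * √n) + D * D' := by
        gcongr
        exacts [h₁ n, h₂ n]
    _ ≤ _ := by
        have := Real.sqrt_nonneg (n : ℝ)
        have : 0 ≤ D * D' * √n := by positivity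
        have : 0 ≤ D' * C₁ := by positivity
        have : 0 ≤ D * C₂ := by positivity
        linarith

end Comparison

variable {a d : ℕ} {A : Fin a → Fin a → Bool} {r : (ℕ → Fin a) → ℕ → Fin a} {ρ : ℝ} {N : ℕ}
  {ψ f₀ : (ℕ → Fin a) → ℝ} {c : ℝ} {f : Fin d → (ℕ → Fin a) → ℝ} {t : Fin d → ℝ}
  {lam : (Fin d → ℝ) → ℝ} {ν : (Fin d → ℝ) → Measure (ℕ → Fin a)}

/-- The logarithmic derivative of the measure of a cylinder is at bounded distance from the
Birkhoff sum of the centred observable. -/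
theorem exists_fderiv_log_sub_birkhoff_le
    (T : RuelleTriple A r ρ N (Fpot f₀ f t) (lam t) ψ c (ν t))
    (hν : ∀ s, Eigenmeasure A (Fpot f₀ f s) (lam s) (ν s)) (hf : ∀ i, Hol ρ (f i))
    (i : Fin d) :
    ∃ D, 0 ≤ D ∧ ∀ n, ∀ x ∈ SFT A,
      |fderiv ℝ (fun s => Real.log (∫ y, cylInd n x y ∂ν s)) t (Pi.single i 1) -
        birkhoff n (fun y => f i y - ∫ z, f i z * ψ z ∂ν t) x| ≤ D := by
  have := T.isProbabilityMeasure
  have h0 := T.rho_pos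
  set F : (ℕ → Fin a) → ℝ := fun y => f i y - ∫ z, f i z * ψ z ∂ν t with hF
  have hFH : Hol ρ F := (hf i).sub h0.le (Hol.const ρ _)
  obtain ⟨B, hB, hw⟩ := T.exists_poisson_cylInd
  obtain ⟨D, hD, hvar⟩ := exists_birkhoff_sub_le h0.le T.rho_lt hFH
  obtain ⟨K, hK, hFK⟩ := hFH.bounded
  refine ⟨D + K * B, by positivity, fun n x hx => ?_⟩
  obtain ⟨hm, w, hwH, hwB, hws⟩ := hw n x hx
  have hcH : Hol ρ (cylInd n x) := hol_cylInd h0 T.rho_lt.le n x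
  have hsH : Hol ρ fun y => ∑ k ∈ Finset.range n,
      (branchOp r (ruelleWeight A (Fpot f₀ f t) (lam t)))^[k] (cylInd n x) y :=
    Hol.sum _ fun k _ => T.hol_iterate hcH k
  have hd := (T.hasFDerivAt_integral hν hf hcH (hsH.add hwH) hws).log hm.ne'
  rw [hd.fderiv]
  set m := ∫ y, cylInd n x y ∂ν t with hmdef
  have e1 : (m⁻¹ • ∑ j, (∫ y, (f j y - ∫ z, f j z * ψ z ∂ν t) *
      (∑ k ∈ Finset.range n,
        (branchOp r (ruelleWeight A (Fpot f₀ f t) (lam t)))^[k] (cylInd n x) y + w y) ∂ν t) •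
      ContinuousLinearMap.proj (R := ℝ) (φ := fun _ : Fin d => ℝ) j) (Pi.single i 1) =
      m⁻¹ * (∫ y, cylInd n x y * birkhoff n F y ∂ν t + ∫ y, F y * w y ∂ν t) := by
    rw [← T.integral_mul_sum_iterate hFH hcH n,
      ← integral_add (f := fun y => F y * ∑ k ∈ Finset.range n,
        (branchOp r (ruelleWeight A (Fpot f₀ f t) (lam t)))^[k] (cylInd n x) y)
        (g := fun y => F y * w y) (T.integrable ((T.cont hFH).mul (T.cont hsH)))
        (T.integrable ((T.cont hFH).mul (T.cont hwH)))]
    simp only [← mul_add]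
    simp [Pi.single_apply, hF]
  rw [e1]
  have b1 := T.abs_integral_cylInd_mul_sub_le hFH (b := x) (n := n) fun y hy => hvar n y x hy
  have b2 : |∫ y, F y * w y ∂ν t| ≤ K * (B * m) := by
    simpa using norm_integral_le_of_norm_le_const (μ := ν t) (f := fun y => F y * w y)
      (C := K * (B * m)) (.of_forall fun y => by
        rw [norm_mul]
        exact mul_le_mul (hFK y) (hwB y) (abs_nonneg _) hK.le)
  have e2 : m⁻¹ * (∫ y, cylInd n x y * birkhoff n F y ∂ν t + ∫ y, F y * w y ∂ν t) -
      birkhoff n F x = m⁻¹ * ((∫ y, cylInd n x y * birkhoff n F y ∂ν t - m * birkhoff n F x) +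
        ∫ y, F y * w y ∂ν t) := by
    field_simp
    ring
  rw [e2, abs_mul, abs_of_pos (inv_pos.2 hm)]
  calc _ ≤ m⁻¹ * (D * m + K * (B * m)) := by
        gcongr
        exact (abs_add_le _ _).trans (add_le_add b1 b2)
    _ = _ := by field_simp

end RuelleTriple

theorem Hol.holderSeq {a : ℕ} {ρ : ℝ} {g : (ℕ → Fin a) → ℝ} (hg : Hol ρ g) (h0 : 0 < ρ)
    (h1 : ρ < 1) : HolderSeq g :=
  ⟨hg.continuous h0.le h1, hg.choose, ρ, h0, h1, hg.choose_spec.2⟩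

theorem hol_Fpot {a d : ℕ} {ρ : ℝ} {f₀ : (ℕ → Fin a) → ℝ} {f : Fin d → (ℕ → Fin a) → ℝ}
    (h0 : 0 ≤ ρ) (hf₀ : Hol ρ f₀) (hf : ∀ i, Hol ρ (f i)) (s : Fin d → ℝ) :
    Hol ρ (Fpot f₀ f s) :=
  hf₀.add (Hol.sum _ fun i _ => (hf i).const_mul h0 (s i))

theorem holderSeq_Fpot {a d : ℕ} {f₀ : (ℕ → Fin a) → ℝ} {f : Fin d → (ℕ → Fin a) → ℝ}
    (hf₀ : HolderSeq f₀) (hf : ∀ i, HolderSeq (f i)) (s : Fin d → ℝ) :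
    HolderSeq (Fpot f₀ f s) := by
  obtain ⟨ρ, h0, h1, h⟩ := exists_common_hol (u := fun o : Option (Fin d) => o.elim f₀ f)
    (by rintro (_ | i); exacts [hf₀, hf i])
  exact (hol_Fpot h0.le (h none) (fun i => h (some i)) s).holderSeq h0 h1

theorem GibbsData.exists_ruelleTriple {a : ℕ} {A : Fin a → Fin a → Bool} (hmix : Mixing A)
    (G : GibbsData a A) {F : (ℕ → Fin a) → ℝ} (hF : HolderSeq F) {ρ : ℝ} (h0 : 0 < ρ)
    (h1 : ρ < 1) (hFρ : Hol ρ F) (hφ : Hol ρ (G.φ F)) :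
    ∃ (r : (ℕ → Fin a) → ℕ → Fin a) (N : ℕ) (c : ℝ),
      RuelleTriple A r ρ N F (Real.exp (G.P F)) (fun x => G.φ F (r x)) c (G.ν F) := by
  obtain ⟨r, hr⟩ := hmix.exists_retraction
  obtain ⟨N, hN⟩ := hmix
  have hE := G.eigen F hF
  have := hE.1
  have hψ : Hol ρ fun x => G.φ F (r x) := hφ.comp_of_agree hr.agree
  obtain ⟨x₀, -⟩ := hE.ae_mem.exists
  obtain ⟨z, -, hz⟩ := isCompact_univ.exists_isMinOn ⟨x₀, Set.mem_univ x₀⟩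
    (hψ.continuous h0.le h1).continuousOn
  refine ⟨r, N, G.φ F (r z), hr, h0, h1, hN N le_rfl, hFρ, Real.exp_pos _, hψ,
    G.φ_pos F hF _ (hr.mem z), fun x => hz (Set.mem_univ x), fun x => ?_, fun x hx => ?_, hE, ?_⟩
  · rw [hr.fixed _ (hr.mem x)]
  · rw [hr.fixed x hx, ← G.φ_eigen F hF x hx]
    refine Finset.sum_congr rfl fun i _ => ?_
    split_ifs with hi
    · simp only [hr.fixed _ (cons_mem_SFT hx hi)]
    · rfl
  · rw [← G.φ_norm F hF]
    refine integral_congr_ae ?_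
    filter_upwards [hE.ae_mem] with x hx
    rw [hr.fixed x hx]

theorem GibbsData.integral_μ {a : ℕ} {A : Fin a → Fin a → Bool} (G : GibbsData a A)
    {F : (ℕ → Fin a) → ℝ} (hF : HolderSeq F) (g : (ℕ → Fin a) → ℝ) :
    ∫ x, g x ∂G.μ F = ∫ x, g x * G.φ F x ∂G.ν F := by
  rw [GibbsData.μ, integral_withDensity_eq_integral_toReal_smul
    (G.φ_holder F hF).1.measurable.ennreal_ofReal (.of_forall fun _ => ENNReal.ofReal_lt_top)]
  refine integral_congr_ae ?_
  filter_upwards [(G.eigen F hF).ae_mem] with x hx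
  rw [ENNReal.toReal_ofReal (G.φ_pos F hF x hx).le, smul_eq_mul, mul_comm]

theorem Eigenmeasure.toReal_cyl {a : ℕ} {A : Fin a → Fin a → Bool} {F : (ℕ → Fin a) → ℝ}
    {lam : ℝ} {ν : Measure (ℕ → Fin a)} (h : Eigenmeasure A F lam ν) (n : ℕ)
    (b : ℕ → Fin a) : (ν (cyl A n b)).toReal = ∫ x, cylInd n b x ∂ν := by
  have hm : MeasurableSet {x : ℕ → Fin a | ∀ i < n, x i = b i} := by
    simp only [Set.ofPred_forall]
    exact .iInter fun i => .iInter fun _ => measurable_pi_apply i (.singleton _)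
  have e : cylInd n b = {x : ℕ → Fin a | ∀ i < n, x i = b i}.indicator fun _ => (1 : ℝ) := by
    funext x
    simp [cylInd, Set.indicator_apply]
  have h1 : ν (cyl A n b) = ν {x | ∀ i < n, x i = b i} := by
    refine measure_congr ?_
    filter_upwards [h.ae_mem] with x hx
    exact propext ⟨fun h => h.2, fun h => ⟨hx, h⟩⟩
  rw [h1, e, integral_indicator_const _ hm, smul_eq_mul, mul_one]
  rfl

theorem continuous_logDeriv {a d : ℕ} (A : Fin a → Fin a → Bool) (G : GibbsData a A)
    (f₀ : (ℕ → Fin a) → ℝ) (f : Fin d → (ℕ → Fin a) → ℝ) (t : Fin d → ℝ) (i : Fin d)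
    (n : ℕ) : Continuous (logDeriv A G f₀ f t i n) := by
  refine continuous_of_forall_agree n fun x y hxy => ?_
  have : cyl A n x = cyl A n y := by
    ext z
    refine and_congr_right fun _ => forall₂_congr fun i hi => by rw [hxy i hi]
  simp only [logDeriv, this]

/-- **Proposition 3.17.** Fix `t ∈ ℝ^d` and let
`Iⁿᵢⱼ(t) = ∫ ∂_i[log ν_s([x₀,…,x_{n−1}])](t) ∂_j[log ν_s([x₀,…,x_{n−1}])](t) dν_t(x)`
be the Fisher information matrix.  Then for all `i, j`, both limits below exist and
`lim (1/n) Iⁿᵢⱼ(t) = lim (1/m) ∫ S_m f̃ᵢᵗ S_m f̃ⱼᵗ dν_t`, where `f̃ᵢᵗ = fᵢ − ∫ fᵢ dμ_t`. -/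
theorem proposition_3_17_fisher_information_limit
    {a d : ℕ} (ha : 2 ≤ a) (A : Fin a → Fin a → Bool) (hmix : Mixing A)
    (G : GibbsData a A)
    (f₀ : (ℕ → Fin a) → ℝ) (f : Fin d → (ℕ → Fin a) → ℝ)
    (hf₀ : HolderSeq f₀) (hf : ∀ i, HolderSeq (f i))
    (t : Fin d → ℝ) :
    ∀ i j : Fin d, ∃ c : ℝ,
      Tendsto (fun n : ℕ => (1 / (n : ℝ)) *
          ∫ x, logDeriv A G f₀ f t i n x * logDeriv A G f₀ f t j n x
            ∂(G.ν (Fpot f₀ f t)))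
        atTop (nhds c) ∧
      Tendsto (fun m : ℕ => (1 / (m : ℝ)) *
          ∫ x, birkhoff m (fun y => f i y - ∫ z, f i z ∂(G.μ (Fpot f₀ f t))) x *
            birkhoff m (fun y => f j y - ∫ z, f j z ∂(G.μ (Fpot f₀ f t))) x
            ∂(G.ν (Fpot f₀ f t)))
        atTop (nhds c) := by
  intro i j
  have hF := holderSeq_Fpot hf₀ hf
  obtain ⟨ρ, h0, h1, hρ⟩ := exists_common_hol
    (u := fun o : Option (Option (Fin d)) => o.elim (G.φ (Fpot f₀ f t)) fun o => o.elim f₀ f)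
    (by rintro (_ | _ | i); exacts [G.φ_holder _ (hF t), hf₀, hf i])
  have hfρ : ∀ i, Hol ρ (f i) := fun i => hρ (some (some i))
  obtain ⟨r, N, c, T⟩ := G.exists_ruelleTriple hmix (hF t) h0 h1
    (hol_Fpot h0.le (hρ (some none)) hfρ t) (hρ none)
  have hν : ∀ s, Eigenmeasure A (Fpot f₀ f s) (Real.exp (G.P (Fpot f₀ f s)))
    (G.ν (Fpot f₀ f s)) := fun s => G.eigen _ (hF s)
  have := T.isProbabilityMeasure
  have hμ : ∀ i, ∫ z, f i z ∂G.μ (Fpot f₀ f t) =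
      ∫ z, f i z * G.φ (Fpot f₀ f t) (r z) ∂G.ν (Fpot f₀ f t) := fun i => by
    rw [G.integral_μ (hF t)]
    refine integral_congr_ae ?_
    filter_upwards [(hν t).ae_mem] with x hx
    rw [T.ret.fixed x hx]
  have hH : ∀ i, Hol ρ fun y => f i y - ∫ z, f i z ∂G.μ (Fpot f₀ f t) := fun i =>
    (hfρ i).sub h0.le (Hol.const ρ _)
  have hzero : ∀ i, ∫ y, (f i y - ∫ z, f i z ∂G.μ (Fpot f₀ f t)) *
      G.φ (Fpot f₀ f t) (r y) ∂G.ν (Fpot f₀ f t) = 0 := fun i => by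
    have hψ := T.cont T.psi_hol
    have hfc := T.cont (hfρ i)
    simp only [sub_mul]
    rw [integral_sub (f := fun y => f i y * G.φ (Fpot f₀ f t) (r y))
        (g := fun y => (∫ z, f i z ∂G.μ (Fpot f₀ f t)) * G.φ (Fpot f₀ f t) (r y))
        (T.integrable (hfc.mul hψ)) (T.integrable (continuous_const.mul hψ)),
      integral_const_mul, T.norm, hμ i, mul_one, sub_self]
  have hscore : ∀ i, ∃ D, 0 ≤ D ∧ ∀ n, ∀ x ∈ SFT A, |logDeriv A G f₀ f t i n x -
      birkhoff n (fun y => f i y - ∫ z, f i z ∂G.μ (Fpot f₀ f t)) x| ≤ D := fun i => by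
    simp only [logDeriv, (hν _).toReal_cyl, hμ]
    exact T.exists_fderiv_log_sub_birkhoff_le hν hfρ i
  obtain ⟨D, hD, hDi⟩ := hscore i
  obtain ⟨D', -, hDj⟩ := hscore j
  obtain ⟨v, C, hv⟩ := T.exists_covariance (hH i) (hH j) (hzero i) (hzero j)
  obtain ⟨C', hC'⟩ := T.exists_integral_mul_sub_le (hH i) (hH j) (hzero i) (hzero j)
    (continuous_logDeriv A G f₀ f t i) (continuous_logDeriv A G f₀ f t j) hD hDi hDj
  refine ⟨v, tendsto_div_of_abs_sub_le (C := C' + C) fun n => ?_,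
    tendsto_div_of_abs_sub_le hv⟩
  refine (abs_sub_le _ _ _).trans ((add_le_add (hC' n) (hv n)).trans_eq ?_)
  ring

end GibbsPaper
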